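/- arXiv:2302.07621 — 15 statements merged into one kernel-verified Lean document; each statement's English description precedes it below -/
import Mathlib

section
/- Fix a principal-agent instance with n actions and m outcomes and an action i. There exists a contract t (with t j ≥ 0 for all outcomes j) such that for every action i', ∑_j p i j * t j - c i ≥ ∑_j p i' j * t j - c i', if and only if there does NOT exist an assignment of coefficients λ i' ∈ [0,1] to the actions i' ≠ i with ∑_{i' ≠ i} λ i' = 1 such that ∑_{i' ≠ i} λ i' * p i' j = p i j for every outcome j and ∑_{i' ≠ i} λ i' * c i' < c i. -/
lemma one_var {ι : Type} [Fintype ι] (a s : ι → ℝ) (h0 : ∀ i, a i = 0 → 0 ≤ s i)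
    (h1 : ∀ i k, 0 < a i → a k < 0 → 0 ≤ -a k * s i + a i * s k) :
    ∃ x : ℝ, ∀ i, a i * x ≤ s i := by
  classical
  by_cases hP : (Finset.univ.filter (fun i => 0 < a i)).Nonempty
  · obtain ⟨q, hq, hmin⟩ := Finset.exists_min_image _ (fun i => s i / a i) hP
    simp only [Finset.mem_filter, Finset.mem_univ, true_and] at hq hmin
    refine ⟨s q / a q, fun i => ?_⟩
    rcases lt_trichotomy (a i) 0 with h | h | h
    · have := h1 q i hq h
      rw [← mul_div_assoc, div_le_iff₀ hq]
      linarith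
    · rw [h, zero_mul]; exact h0 i h
    · have := hmin i h
      rw [le_div_iff₀ h] at this
      linarith
  · have hP' : ∀ i, a i ≤ 0 := by
      intro i
      by_contra h
      exact hP ⟨i, by simpa using h⟩
    by_cases hN : (Finset.univ.filter (fun i => a i < 0)).Nonempty
    · obtain ⟨q, hq, hmin⟩ := Finset.exists_max_image _ (fun i => s i / a i) hN
      simp only [Finset.mem_filter, Finset.mem_univ, true_and] at hq hmin
      refine ⟨s q / a q, fun i => ?_⟩
      rcases (hP' i).lt_or_eq with h | h
      · have := hmin i h
        rw [div_le_iff_of_neg h] at this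
        linarith
      · rw [h, zero_mul]; exact h0 i h
    · refine ⟨0, fun i => ?_⟩
      rw [mul_zero]
      apply h0
      by_contra h
      exact hN ⟨i, by simpa using lt_of_le_of_ne (hP' i) h⟩

open Classical in
noncomputable def fmW {ι : Type} (a : ι → ℝ) : ι ⊕ ι × ι → ι → ℝ
  | Sum.inl i => if a i = 0 then Pi.single i 1 else 0
  | Sum.inr (i, k) =>
      if 0 < a i ∧ a k < 0 then Pi.single i (-a k) + Pi.single k (a i) else 0

lemma fmW_nonneg {ι : Type} (a : ι → ℝ) (e : ι ⊕ ι × ι) (l : ι) : 0 ≤ fmW a e l := by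
  classical
  have hs : ∀ (i : ι) (x : ℝ), 0 ≤ x → 0 ≤ (Pi.single i x : ι → ℝ) l := by
    intro i x hx
    rw [Pi.single_apply]; split_ifs <;> simp [hx]
  rcases e with i | ⟨i, k⟩
  · simp only [fmW]
    split_ifs
    · convert hs i 1 zero_le_one
    · simp
  · simp only [fmW]
    split_ifs with h
    · rw [Pi.add_apply]
      have h1 := hs i (-a k) (by linarith [h.2])
      have h2 := hs k (a i) h.1.le
      convert add_nonneg h1 h2
    · simp

lemma fmW_sum {ι : Type} [Fintype ι] (a : ι → ℝ) (e : ι ⊕ ι × ι) :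
    ∑ l, fmW a e l * a l = 0 := by
  classical
  rcases e with i | ⟨i, k⟩
  · simp only [fmW]
    split_ifs with h
    · simp [Pi.single_apply, h]
    · simp
  · simp only [fmW]
    split_ifs with h
    · simp [Pi.single_apply, add_mul, Finset.sum_add_distrib]; ring
    · simp

lemma farkas_fm (m : ℕ) : ∀ {ι : Type} [Fintype ι] (A : ι → Fin m → ℝ) (b : ι → ℝ),
    (∀ y : ι → ℝ, (∀ i, 0 ≤ y i) → (∀ j, ∑ i, y i * A i j = 0) → 0 ≤ ∑ i, y i * b i) →
    ∃ t : Fin m → ℝ, ∀ i, ∑ j, A i j * t j ≤ b i := by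
  classical
  induction m with
  | zero =>
    intro ι _ A b h
    refine ⟨0, fun i => ?_⟩
    have := h (Pi.single i 1) (fun k => by rw [Pi.single_apply]; split_ifs <;> simp)
      (fun j => j.elim0)
    simpa [Pi.single_apply] using this
  | succ m ih =>
    intro ι _ A b h
    let a : ι → ℝ := fun i => A i 0
    have key : ∀ (y : ι ⊕ ι × ι → ℝ) (v : ι → ℝ),
        ∑ e, y e * ∑ l, fmW a e l * v l = ∑ l, (∑ e, y e * fmW a e l) * v l := by
      intro y v
      simp only [Finset.mul_sum, Finset.sum_mul]
      rw [Finset.sum_comm]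
      simp only [mul_assoc]
    obtain ⟨t, ht⟩ := ih (ι := ι ⊕ ι × ι) (fun e j => ∑ l, fmW a e l * A l j.succ)
      (fun e => ∑ l, fmW a e l * b l) (by
        intro y hy hA
        rw [key]
        apply h
        · intro l
          exact Finset.sum_nonneg fun e _ => mul_nonneg (hy e) (fmW_nonneg a e l)
        · intro j
          refine Fin.cases ?_ (fun j => ?_) j
          · rw [← key y (fun l => A l 0)]
            exact Finset.sum_eq_zero fun e _ => by
              rw [show ∑ l, fmW a e l * A l 0 = 0 from fmW_sum a e, mul_zero]
          · rw [← key y (fun l => A l j.succ)]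
            exact hA j)
    let s : ι → ℝ := fun l => b l - ∑ j : Fin m, A l j.succ * t j
    have hs : ∀ e, 0 ≤ ∑ l, fmW a e l * s l := by
      intro e
      have h1 := ht e
      have h2 : ∑ l, fmW a e l * s l = ∑ l, fmW a e l * b l
          - ∑ j, (∑ l, fmW a e l * A l j.succ) * t j := by
        simp only [s, mul_sub, Finset.sum_sub_distrib, Finset.mul_sum, Finset.sum_mul]
        congr 1
        rw [Finset.sum_comm]
        simp only [mul_assoc]
      rw [h2]; linarith
    obtain ⟨x, hx⟩ := one_var a s
      (by
        intro i hi
        have := hs (Sum.inl i)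
        simpa [fmW, hi, Pi.single_apply] using this)
      (by
        intro i k hi hk
        have := hs (Sum.inr (i, k))
        simpa [fmW, hi, hk, Pi.single_apply, add_mul, Finset.sum_add_distrib] using this)
    refine ⟨Fin.cons x t, fun l => ?_⟩
    rw [Fin.sum_univ_succ]
    simp only [Fin.cons_zero, Fin.cons_succ]
    have := hx l
    simp only [a, s] at this
    linarith

/-- An action `i` is implementable (there is a nonnegative contract making `i`
incentive compatible) iff there is no convex combination of the other actions
that yields the same distribution over outcomes at a strictly lower cost. -/
theorem implementable_iff_no_cheaper_convex_combination
    (n m : ℕ) (p : Fin n → Fin m → ℝ) (c : Fin n → ℝ) (r : Fin m → ℝ)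
    (hp : ∀ i j, 0 ≤ p i j) (hp1 : ∀ i, ∑ j, p i j = 1)
    (hc : ∀ i, 0 ≤ c i) (hr : ∀ j, 0 ≤ r j)
    (i : Fin n) :
    (∃ t : Fin m → ℝ, (∀ j, 0 ≤ t j) ∧
        ∀ i' : Fin n, (∑ j, p i' j * t j) - c i' ≤ (∑ j, p i j * t j) - c i) ↔
      ¬ ∃ lam : Fin n → ℝ,
          (∀ i' : Fin n, i' ≠ i → 0 ≤ lam i' ∧ lam i' ≤ 1) ∧
          (∑ i' ∈ Finset.univ.erase i, lam i') = 1 ∧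
          (∀ j : Fin m, ∑ i' ∈ Finset.univ.erase i, lam i' * p i' j = p i j) ∧
          (∑ i' ∈ Finset.univ.erase i, lam i' * c i') < c i := by
  constructor
  · rintro ⟨t, -, ht⟩ ⟨lam, hl, h1, hpj, hcost⟩
    have h2 : ∑ i' ∈ Finset.univ.erase i, lam i' * ((∑ j, p i' j * t j) - c i')
        ≤ ∑ i' ∈ Finset.univ.erase i, lam i' * ((∑ j, p i j * t j) - c i) :=
      Finset.sum_le_sum fun k hk =>
        mul_le_mul_of_nonneg_left (ht k) (hl k (Finset.ne_of_mem_erase hk)).1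
    rw [← Finset.sum_mul, h1, one_mul] at h2
    have h3 : ∑ i' ∈ Finset.univ.erase i, lam i' * (∑ j, p i' j * t j)
        = ∑ j, p i j * t j := by
      simp only [← hpj, Finset.mul_sum, Finset.sum_mul]
      rw [Finset.sum_comm]
      simp only [mul_assoc]
    simp only [mul_sub, Finset.sum_sub_distrib] at h2
    rw [h3] at h2
    linarith
  · intro hno
    obtain ⟨t, ht⟩ := farkas_fm m (fun k j => p k j - p i j) (fun k => c k - c i) (by
      intro y hy hA
      by_contra hneg
      push Not at hneg
      have er : ∀ f : Fin n → ℝ, f i = 0 → ∑ k ∈ Finset.univ.erase i, f k = ∑ k, f k :=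
        fun f hf => Finset.sum_erase _ hf
      set S := ∑ k ∈ Finset.univ.erase i, y k with hS
      have hS0 : 0 ≤ S := Finset.sum_nonneg fun k _ => hy k
      have hA' : ∀ j, ∑ k ∈ Finset.univ.erase i, y k * p k j = S * p i j := by
        intro j
        have := hA j
        rw [← er _ (by simp)] at this
        simp only [mul_sub, Finset.sum_sub_distrib] at this
        rw [← Finset.sum_mul] at this
        linarith
      rw [← er _ (by simp)] at hneg
      have hSpos : 0 < S := by
        rcases hS0.lt_or_eq with h | h
        · exact h
        · exfalso
          have hz := (Finset.sum_eq_zero_iff_of_nonneg (fun k _ => hy k)).1 h.symm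
          rw [Finset.sum_eq_zero (fun k hk => by rw [hz k hk, zero_mul])] at hneg
          exact lt_irrefl _ hneg
      simp only [mul_sub, Finset.sum_sub_distrib] at hneg
      rw [← Finset.sum_mul] at hneg
      apply hno
      refine ⟨fun k => y k / S, fun k hk => ⟨div_nonneg (hy k) hS0, ?_⟩, ?_, fun j => ?_, ?_⟩
      · rw [div_le_one hSpos]
        exact Finset.single_le_sum (f := y) (fun k _ => hy k)
          (Finset.mem_erase.2 ⟨hk, Finset.mem_univ k⟩)
      · rw [← Finset.sum_div, div_self hSpos.ne']
      · simp only [div_mul_eq_mul_div]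
        rw [← Finset.sum_div, hA' j, mul_div_cancel_left₀ _ hSpos.ne']
      · simp only [div_mul_eq_mul_div]
        rw [← Finset.sum_div, div_lt_iff₀ hSpos]
        linarith)
    refine ⟨fun j => t j + ∑ l, |t l|, fun j => ?_, fun k => ?_⟩
    · have := Finset.single_le_sum (f := fun l => |t l|) (fun l _ => abs_nonneg _)
        (Finset.mem_univ j)
      have h2 := neg_abs_le (t j)
      linarith
    · have := ht k
      simp only [sub_mul, Finset.sum_sub_distrib] at this
      simp only [mul_add, Finset.sum_add_distrib]
      rw [← Finset.sum_mul, ← Finset.sum_mul, hp1, hp1]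
      linarith
end

section
/- Fix a principal-agent instance and let τ be a finite nonempty set of contracts such that any two contracts s, s' ∈ τ are pointwise comparable, i.e., either s j ≤ s' j for all outcomes j or s' j ≤ s j for all outcomes j. Then there exists a single contract s₀ ∈ τ such that for every action i, min_{s ∈ τ} U i s = U i s₀; hence an ambiguous contract drawn from a class of contracts with the no-proper-crossing property is equivalent to a single contract from that class. -/
/-- An ambiguous contract whose contracts are pairwise pointwise-comparable
(no proper crossing) is equivalent to a single contract from the set: some
`s₀ ∈ τ` achieves every action's max-min utility. -/
theorem npc_ambiguous_contract_equivalent_to_single_contract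
    (n m : ℕ) (p : Fin n → Fin m → ℝ) (c : Fin n → ℝ) (r : Fin m → ℝ)
    (hp : ∀ i j, 0 ≤ p i j) (hp1 : ∀ i, ∑ j, p i j = 1)
    (hc : ∀ i, 0 ≤ c i) (hr : ∀ j, 0 ≤ r j)
    (τ : Finset (Fin m → ℝ)) (hτ : τ.Nonempty)
    (hτpos : ∀ s ∈ τ, ∀ j, 0 ≤ s j)
    (hcomp : ∀ s ∈ τ, ∀ s' ∈ τ, (∀ j, s j ≤ s' j) ∨ (∀ j, s' j ≤ s j)) :
    ∃ s₀ ∈ τ, ∀ i : Fin n,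
      τ.inf' hτ (fun s => (∑ j, p i j * s j) - c i) =
        (∑ j, p i j * s₀ j) - c i := by
  obtain ⟨s₀, hs₀⟩ := τ.exists_minimal hτ
  refine ⟨s₀, hs₀.1, fun i => le_antisymm (Finset.inf'_le _ hs₀.1) ?_⟩
  refine Finset.le_inf' _ _ fun s hs => ?_
  have h : ∀ j, s₀ j ≤ s j := by
    rcases hcomp s₀ hs₀.1 s hs with h | h
    · exact h
    · exact hs₀.2 hs h
  exact sub_le_sub_right
    (Finset.sum_le_sum fun j _ => mul_le_mul_of_nonneg_left (h j) (hp i j)) _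
end

section
/- Let t, t' : ℝ → ℝ satisfy t x ≥ 0 and t' x ≥ 0 for all x ≥ 0, let r : Fin m → ℝ with r j ≥ 0 for all j, and let q : Fin m → ℝ with q j ≥ 0 and ∑_j q j = 1. Suppose ∑_j q j * t (r j) = ∑_j q j * t' (r j) and there exists an outcome j₀ with q j₀ > 0 and t (r j₀) ≠ t' (r j₀). Construct the principal-agent instance with m outcomes (rewards r) and m+1 actions in which, for each i ∈ Fin m, action i puts probability 1 on outcome i and has cost min(t (r i), t' (r i)), and action m+1 has distribution q and cost C := ∑_j q j * t (r j). Then: (a) the two contracts s j := t (r j) and s' j := t' (r j) give action m+1 the same expected payment, equal to C, so action m+1 has max-min agent utility 0 under the ambiguous contract {s, s'}, while every action i ∈ Fin m has min(U i s, U i s') ≤ 0 (the ambiguous contract {s, s'} incentivizes action m+1 at cost); and (b) no single contract u : Fin m → ℝ with u j ≥ 0 for all j satisfies ∑_j q j * u j - C ≥ u i - min(t (r i), t' (r i)) for every i ∈ Fin m, i.e., action m+1 is not implementable by any single contract. -/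
/-- (ii) implies (i) in the manipulability characterization: from two contracts
agreeing in expectation under `q` but differing on an outcome with positive
probability, one constructs an instance where the ambiguous contract `{s, s'}`
incentivizes action `m+1` at cost, while no single contract implements it. -/
theorem manipulability_construction
    (m : ℕ) (t t' : ℝ → ℝ)
    (ht : ∀ x : ℝ, 0 ≤ x → 0 ≤ t x) (ht' : ∀ x : ℝ, 0 ≤ x → 0 ≤ t' x)
    (r : Fin m → ℝ) (hr : ∀ j, 0 ≤ r j)
    (q : Fin m → ℝ) (hq : ∀ j, 0 ≤ q j) (hq1 : ∑ j, q j = 1)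
    (heq : ∑ j, q j * t (r j) = ∑ j, q j * t' (r j))
    (hdiff : ∃ j₀ : Fin m, 0 < q j₀ ∧ t (r j₀) ≠ t' (r j₀)) :
    -- (a) both contracts give action `m+1` expected payment `C = ∑ j, q j * t (r j)`,
    -- so its max-min utility is `0` ...
    (min ((∑ j, q j * t (r j)) - (∑ j, q j * t (r j)))
         ((∑ j, q j * t' (r j)) - (∑ j, q j * t (r j))) = 0) ∧
    -- ... while every action `i : Fin m` (probability 1 on outcome `i`,
    -- cost `min (t (r i)) (t' (r i))`) has max-min utility at most `0`:
    (∀ i : Fin m,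
      min (t (r i) - min (t (r i)) (t' (r i)))
          (t' (r i) - min (t (r i)) (t' (r i))) ≤ 0) ∧
    -- (b) no single contract implements action `m+1`:
    ¬ ∃ u : Fin m → ℝ, (∀ j, 0 ≤ u j) ∧
        ∀ i : Fin m,
          u i - min (t (r i)) (t' (r i)) ≤
            (∑ j, q j * u j) - (∑ j, q j * t (r j)) := by
  refine ⟨by rw [← heq]; simp, fun i => ?_, ?_⟩
  · rcases le_total (t (r i)) (t' (r i)) with h | h
    · simp [h]
    · simp [h]
  · rintro ⟨u, -, hu⟩
    obtain ⟨j₀, hj₀, hne⟩ := hdiff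
    have h1 : ∑ j, q j * (u j - min (t (r j)) (t' (r j))) ≤
        ∑ j, q j * ((∑ j, q j * u j) - (∑ j, q j * t (r j))) :=
      Finset.sum_le_sum fun j _ => mul_le_mul_of_nonneg_left (hu j) (hq j)
    rw [← Finset.sum_mul, hq1, one_mul] at h1
    simp only [mul_sub, Finset.sum_sub_distrib] at h1
    have h2 : ∑ j, (q j * min (t (r j)) (t' (r j)) + q j * min (t (r j)) (t' (r j))) <
        ∑ j, (q j * t (r j) + q j * t' (r j)) := by
      refine Finset.sum_lt_sum (fun j _ => ?_) ⟨j₀, Finset.mem_univ _, ?_⟩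
      · exact add_le_add (mul_le_mul_of_nonneg_left (min_le_left _ _) (hq j))
          (mul_le_mul_of_nonneg_left (min_le_right _ _) (hq j))
      · rw [← mul_add, ← mul_add]
        refine mul_lt_mul_of_pos_left ?_ hj₀
        rcases lt_or_gt_of_ne hne with h | h
        · rw [min_eq_left h.le]; linarith
        · rw [min_eq_right h.le]; linarith
    simp only [Finset.sum_add_distrib] at h2
    linarith
end

section
/- Fix a principal-agent instance (with r j ≥ 0 for all outcomes j) and a finite nonempty set A ⊆ [0,1]. For α ∈ A let t^α be the linear contract defined by t^α j = α * r j. Then there exists α₀ ∈ A such that for every action i, min_{α ∈ A} U i t^α = U i t^{α₀}; that is, any ambiguous contract composed of linear contracts is equivalent to a single linear contract, so the class of linear contracts is non-manipulable. -/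
/-- Linear contracts are non-manipulable: an ambiguous contract composed of
linear contracts (with slopes from a finite nonempty `A ⊆ [0,1]`) is equivalent
to a single linear contract. -/
theorem linear_contracts_non_manipulable
    (n m : ℕ) (p : Fin n → Fin m → ℝ) (c : Fin n → ℝ) (r : Fin m → ℝ)
    (hp : ∀ i j, 0 ≤ p i j) (hp1 : ∀ i, ∑ j, p i j = 1)
    (hc : ∀ i, 0 ≤ c i) (hr : ∀ j, 0 ≤ r j)
    (A : Finset ℝ) (hA : A.Nonempty) (hA01 : ∀ α ∈ A, 0 ≤ α ∧ α ≤ 1) :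
    ∃ α₀ ∈ A, ∀ i : Fin n,
      A.inf' hA (fun α => (∑ j, p i j * (α * r j)) - c i) =
        (∑ j, p i j * (α₀ * r j)) - c i := by
  refine ⟨A.min' hA, A.min'_mem hA, fun i => le_antisymm ?_ ?_⟩
  · exact Finset.inf'_le (fun α => (∑ j, p i j * (α * r j)) - c i) (A.min'_mem hA)
  · refine Finset.le_inf' hA _ fun α hα => ?_
    refine sub_le_sub_right (Finset.sum_le_sum fun j _ => ?_) _
    exact mul_le_mul_of_nonneg_left
      (mul_le_mul_of_nonneg_right (A.min'_le α hα) (hr j)) (hp i j)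
end

section
/- Fix a principal-agent instance with n actions and m outcomes, an action i*, and a finite nonempty set τ of contracts that is consistent with respect to i* with common expected payment P = T i* t for all t ∈ τ, where P ≥ 0, and that incentivizes i*: min_{t ∈ τ} U i* t ≥ min_{t ∈ τ} U i t for every action i. Then there exists a finite set τ' of contracts with cardinality at most min(m, n-1) such that: every t ∈ τ' is a single-outcome-payment contract (t j = 0 for all but at most one outcome j); T i* t = P for every t ∈ τ'; and for every action i ≠ i* there exists t ∈ τ' with U i t ≤ P - c i*. Consequently τ' is consistent with respect to i* with the same expected payment P and incentivizes i*. -/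
theorem sop_aux {m : ℕ} (q ps t : Fin m → ℝ) (P D : ℝ)
    (hq : ∀ j, 0 ≤ q j) (hps : ∀ j, 0 ≤ ps j) (hps1 : ∑ j, ps j = 1)
    (ht : ∀ j, 0 ≤ t j) (hP : 0 ≤ P) (hT : ∑ j, ps j * t j = P)
    (hD : ∑ j, q j * t j ≤ D) :
    ∃ j, 0 < ps j ∧ q j * (P / ps j) ≤ D := by
  by_contra hcon
  push Not at hcon
  rcases hP.eq_or_lt with h0 | hpos
  · have hex : ∃ j ∈ Finset.univ, 0 < ps j := by
      apply Finset.exists_lt_of_sum_lt (s := Finset.univ) (f := fun _ => (0 : ℝ))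
      simp [hps1]
    obtain ⟨j, -, hj⟩ := hex
    have h1 := hcon j hj
    rw [← h0] at h1
    have h2 : 0 ≤ ∑ j, q j * t j := Finset.sum_nonneg fun j _ => mul_nonneg (hq j) (ht j)
    simp at h1
    linarith
  · have key : ∀ j, 0 < ps j → D * ps j < q j * P := by
      intro j hj
      have h1 := hcon j hj
      rw [← mul_div_assoc, lt_div_iff₀ hj] at h1
      exact h1
    have hex : ∃ j ∈ Finset.univ, 0 < ps j * t j := by
      apply Finset.exists_lt_of_sum_lt (s := Finset.univ) (f := fun _ => (0 : ℝ))
      simpa [hT] using hpos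
    obtain ⟨j, -, hj⟩ := hex
    have hlt : ∑ j, D * (ps j * t j) < ∑ j, (q j * t j) * P := by
      apply Finset.sum_lt_sum
      · intro k _
        rcases (hps k).eq_or_lt with h | h
        · rw [← h]
          have := mul_nonneg (mul_nonneg (hq k) (ht k)) hP
          simpa using this
        · have := mul_le_mul_of_nonneg_right (key k h).le (ht k)
          linarith
      · have h1 : 0 < ps j := pos_of_mul_pos_left hj (ht j)
        have h2 : 0 < t j := pos_of_mul_pos_right hj (hps j)
        have := mul_lt_mul_of_pos_right (key j h1) h2
        exact ⟨j, Finset.mem_univ j, by linarith⟩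
    rw [← Finset.mul_sum, ← Finset.sum_mul, hT] at hlt
    have := mul_le_mul_of_nonneg_right hD hP
    linarith

/-- Structure of optimal ambiguous contracts: any consistent ambiguous contract
incentivizing `istar` with expected payment `P` can be replaced by at most
`min m (n-1)` single-outcome-payment contracts with the same expected payment
for `istar`, which again form a consistent incentivizing ambiguous contract. -/
theorem ambiguous_contract_wlog_SOP
    (n m : ℕ) (p : Fin n → Fin m → ℝ) (c : Fin n → ℝ) (r : Fin m → ℝ)
    (hp : ∀ i j, 0 ≤ p i j) (hp1 : ∀ i, ∑ j, p i j = 1)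
    (hc : ∀ i, 0 ≤ c i) (hr : ∀ j, 0 ≤ r j)
    (istar : Fin n)
    (τ : Finset (Fin m → ℝ)) (hτ : τ.Nonempty)
    (hτpos : ∀ t ∈ τ, ∀ j, 0 ≤ t j)
    (P : ℝ) (hP : 0 ≤ P)
    (hcons : ∀ t ∈ τ, ∑ j, p istar j * t j = P)
    (hinc : ∀ i : Fin n,
      τ.inf' hτ (fun t => (∑ j, p i j * t j) - c i) ≤
        τ.inf' hτ (fun t => (∑ j, p istar j * t j) - c istar)) :
    ∃ τ' : Finset (Fin m → ℝ),
      τ'.card ≤ min m (n - 1) ∧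
      (∀ t ∈ τ', ∀ j, 0 ≤ t j) ∧
      (∀ t ∈ τ', ∃ j₀ : Fin m, ∀ j, j ≠ j₀ → t j = 0) ∧
      (∀ t ∈ τ', ∑ j, p istar j * t j = P) ∧
      (∀ i : Fin n, i ≠ istar →
        ∃ t ∈ τ', (∑ j, p i j * t j) - c i ≤ P - c istar) := by
  classical
  have hex : ∀ i : Fin n, ∃ j, 0 < p istar j ∧
      p i j * (P / p istar j) ≤ P - c istar + c i := by
    intro i
    obtain ⟨t, ht, hte⟩ := Finset.exists_mem_eq_inf' hτ
      (fun t => (∑ j, p i j * t j) - c i)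
    have h1 := hinc i
    rw [hte] at h1
    have h2 := h1.trans (Finset.inf'_le _ ht)
    simp only [hcons t ht] at h2
    exact sop_aux (p i) (p istar) t P _ (hp i) (hp istar) (hp1 istar) (hτpos t ht) hP
      (hcons t ht) (by linarith)
  choose f hf hfle using hex
  have hs : ∀ (i : Fin n) (j : Fin m) (a : ℝ),
      ∑ k, p i k * (Pi.single j a : Fin m → ℝ) k = p i j * a := by
    intro i j a
    simp [Pi.single_apply]
  refine ⟨((Finset.univ.erase istar).image f).image
    (fun j => Pi.single j (P / p istar j)), ?_, ?_, ?_, ?_, ?_⟩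
  · refine Finset.card_image_le.trans (le_min ?_ ?_)
    · simpa using Finset.card_le_univ ((Finset.univ.erase istar).image f)
    · refine Finset.card_image_le.trans ?_
      simp
  · intro t ht j
    simp only [Finset.mem_image] at ht
    obtain ⟨_, ⟨i, _, rfl⟩, rfl⟩ := ht
    rw [Pi.single_apply]
    split_ifs
    · exact div_nonneg hP (hf i).le
    · exact le_rfl
  · intro t ht
    simp only [Finset.mem_image] at ht
    obtain ⟨_, ⟨i, _, rfl⟩, rfl⟩ := ht
    exact ⟨f i, fun j hj => Pi.single_eq_of_ne hj _⟩
  · intro t ht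
    simp only [Finset.mem_image] at ht
    obtain ⟨_, ⟨i, _, rfl⟩, rfl⟩ := ht
    rw [hs]
    exact mul_div_cancel₀ P (hf i).ne'
  · intro i hi
    refine ⟨_, Finset.mem_image_of_mem _ (Finset.mem_image_of_mem f
      (Finset.mem_erase.2 ⟨hi, Finset.mem_univ i⟩)), ?_⟩
    rw [hs]
    linarith [hfle i]
end

section
/- Fix a principal-agent instance such that for every pair of distinct actions i₁ ≠ i₂ there is an outcome j with p i₁ j > p i₂ j, and fix an action i. For every action i' ≠ i with c i' < c i, the set J i' = {j : p i j > p i' j} is nonempty; define θ_{i'} = min_{j ∈ J i'} p i j * (c i - c i') / (p i j - p i' j), and let θ be the maximum of c i and of θ_{i'} over all i' ≠ i with c i' < c i (so θ = c i if no such i' exists). Then: (a) there exists a finite nonempty set τ of single-outcome-payment contracts with T i t = θ for every t ∈ τ, such that for every action i' ≠ i there is t ∈ τ with U i' t ≤ θ - c i (so τ is consistent with respect to i and incentivizes i with expected payment θ); and (b) every finite nonempty set τ' of contracts that is consistent with respect to i with common expected payment P' satisfying P' ≥ c i, and such that for every action i' there is t ∈ τ' with U i' t ≤ P' - c i, must have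 P' ≥ θ. Hence θ is the minimum expected payment at which action i can be incentivized by an ambiguous contract. -/
/-- Correctness and optimality of the algorithm for the optimal ambiguous
contract incentivizing action `i`: the threshold `θ` (the maximum of `c i` and
of the quantities `θ_{i'}` over cheaper actions `i'`) is exactly the minimum
expected payment at which action `i` can be incentivized by a (consistent)
ambiguous contract, and it is attained by a set of SOP contracts. -/
theorem optimal_ambiguous_contract_theta
    (n m : ℕ) (p : Fin n → Fin m → ℝ) (c : Fin n → ℝ) (r : Fin m → ℝ)
    (hp : ∀ i j, 0 ≤ p i j) (hp1 : ∀ i, ∑ j, p i j = 1)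
    (hc : ∀ i, 0 ≤ c i) (hr : ∀ j, 0 ≤ r j)
    (hdist : ∀ i₁ i₂ : Fin n, i₁ ≠ i₂ → ∃ j, p i₂ j < p i₁ j)
    (i : Fin n)
    (hJ : ∀ i' : Fin n, c i' < c i →
      (Finset.univ.filter (fun j : Fin m => p i' j < p i j)).Nonempty)
    (Θ : Fin n → ℝ)
    (hΘ : ∀ (i' : Fin n) (h : c i' < c i),
      Θ i' = (Finset.univ.filter (fun j : Fin m => p i' j < p i j)).inf' (hJ i' h)
          (fun j => p i j * (c i - c i') / (p i j - p i' j)))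
    (θ : ℝ)
    (hθ : θ = if h : (Finset.univ.filter (fun i' : Fin n => c i' < c i)).Nonempty
        then max (c i) ((Finset.univ.filter (fun i' : Fin n => c i' < c i)).sup' h Θ)
        else c i) :
    -- (a) there is an ambiguous contract of SOP contracts, consistent w.r.t. `i`
    -- with expected payment `θ`, incentivizing `i`:
    (∃ τ : Finset (Fin m → ℝ), τ.Nonempty ∧
        (∀ t ∈ τ, ∀ j, 0 ≤ t j) ∧
        (∀ t ∈ τ, ∃ j₀ : Fin m, ∀ j, j ≠ j₀ → t j = 0) ∧
        (∀ t ∈ τ, ∑ j, p i j * t j = θ) ∧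
        (∀ i' : Fin n, i' ≠ i →
          ∃ t ∈ τ, (∑ j, p i' j * t j) - c i' ≤ θ - c i)) ∧
    -- (b) every consistent incentivizing ambiguous contract pays at least `θ`:
    (∀ (τ' : Finset (Fin m → ℝ)) (P' : ℝ), τ'.Nonempty →
        (∀ t ∈ τ', ∀ j, 0 ≤ t j) →
        (∀ t ∈ τ', ∑ j, p i j * t j = P') →
        c i ≤ P' →
        (∀ i' : Fin n, ∃ t ∈ τ', (∑ j, p i' j * t j) - c i' ≤ P' - c i) →
        θ ≤ P') := by
  have hθc : c i ≤ θ := by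
    rw [hθ]; split_ifs
    · exact le_max_left _ _
    · exact le_rfl
  have hθ0 : 0 ≤ θ := (hc i).trans hθc
  have hθΘ : ∀ i', c i' < c i → Θ i' ≤ θ := by
    intro i' h
    have hmem : i' ∈ Finset.univ.filter (fun i' : Fin n => c i' < c i) := by simpa using h
    rw [hθ, dif_pos ⟨i', hmem⟩]
    exact (Finset.le_sup' Θ hmem).trans (le_max_right _ _)
  have hsum : ∀ (k : Fin n) (j : Fin m) (x : ℝ),
      ∑ j', p k j' * (Pi.single j x : Fin m → ℝ) j' = p k j * x := by
    intro k j x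
    rw [Finset.sum_eq_single j]
    · simp
    · intro b _ hb
      simp [hb]
    · simp
  constructor
  · classical
    refine ⟨(Finset.univ.filter (fun j => 0 < p i j)).image
      (fun j => (Pi.single j (θ / p i j) : Fin m → ℝ)), ?_, ?_, ?_, ?_, ?_⟩
    · rw [Finset.image_nonempty]
      by_contra hne
      rw [Finset.not_nonempty_iff_eq_empty, Finset.filter_eq_empty_iff] at hne
      have h0 : ∑ j, p i j ≤ 0 := Finset.sum_nonpos fun j hj => not_lt.mp (hne hj)
      rw [hp1] at h0
      linarith
    · intro t ht j
      obtain ⟨k, hk, rfl⟩ := Finset.mem_image.mp ht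
      have h0 : 0 ≤ θ / p i k := div_nonneg hθ0 (hp i k)
      by_cases hjk : j = k
      · subst hjk; simpa using h0
      · simp [hjk]
    · intro t ht
      obtain ⟨k, hk, rfl⟩ := Finset.mem_image.mp ht
      exact ⟨k, fun j hj => by simp [hj]⟩
    · intro t ht
      obtain ⟨k, hk, rfl⟩ := Finset.mem_image.mp ht
      have hk' : 0 < p i k := by simpa using hk
      rw [hsum]
      field_simp
    · intro i' hne
      have key : ∃ j, p i' j < p i j ∧ p i' j * (θ / p i j) - c i' ≤ θ - c i := by
        by_cases h : c i' < c i
        · obtain ⟨j, hj, hje⟩ := Finset.exists_mem_eq_inf' (hJ i' h)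
            (fun j => p i j * (c i - c i') / (p i j - p i' j))
          have hj' : p i' j < p i j := by simpa using hj
          refine ⟨j, hj', ?_⟩
          have h1 := hθΘ i' h
          rw [hΘ i' h, hje] at h1
          have hpos : 0 < p i j := lt_of_le_of_lt (hp i' j) hj'
          rw [div_le_iff₀ (by linarith)] at h1
          have h2 : p i' j * (θ / p i j) ≤ θ - c i + c i' := by
            rw [← mul_div_assoc, div_le_iff₀ hpos]
            nlinarith
          linarith
        · obtain ⟨j, hj⟩ := hdist i i' hne.symm
          refine ⟨j, hj, ?_⟩
          have hpos : 0 < p i j := lt_of_le_of_lt (hp i' j) hj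
          have h2 : p i' j * (θ / p i j) ≤ θ := by
            rw [← mul_div_assoc, div_le_iff₀ hpos]
            nlinarith
          linarith
      obtain ⟨j, hj, hle⟩ := key
      refine ⟨_, Finset.mem_image.mpr ⟨j, ?_, rfl⟩, ?_⟩
      · simpa using lt_of_le_of_lt (hp i' j) hj
      · rw [hsum]; exact hle
  · intro τ' P' _ hnn hcons hP hinc
    have key : ∀ i', c i' < c i → Θ i' ≤ P' := by
      intro i' h
      obtain ⟨t, ht, hle⟩ := hinc i'
      have hd : 0 < c i - c i' := by linarith
      have hΘ0 : 0 ≤ Θ i' := by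
        rw [hΘ i' h]
        refine Finset.le_inf' _ _ fun j hj => ?_
        have hj' : p i' j < p i j := by simpa using hj
        exact div_nonneg (mul_nonneg (hp i j) hd.le) (by linarith)
      have hpt : ∀ j, (p i j - p i' j) * Θ i' ≤ p i j * (c i - c i') := by
        intro j
        by_cases hj : p i' j < p i j
        · have h1 : Θ i' ≤ p i j * (c i - c i') / (p i j - p i' j) := by
            rw [hΘ i' h]
            exact Finset.inf'_le (fun j => p i j * (c i - c i') / (p i j - p i' j))
              (by simpa using hj)
          rw [le_div_iff₀ (by linarith)] at h1
          linarith
        · have h1 := mul_nonneg (hp i j) hd.le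
          have h2 : (p i j - p i' j) * Θ i' ≤ 0 :=
            mul_nonpos_of_nonpos_of_nonneg (by linarith) hΘ0
          linarith
      have hs : ∑ j, ((p i j * t j) * Θ i' - (p i' j * t j) * Θ i')
          ≤ ∑ j, (p i j * t j) * (c i - c i') := by
        refine Finset.sum_le_sum fun j _ => ?_
        have := mul_le_mul_of_nonneg_right (hpt j) (hnn t ht j)
        linarith
      rw [Finset.sum_sub_distrib, ← Finset.sum_mul, ← Finset.sum_mul, ← Finset.sum_mul,
        hcons t ht] at hs
      have h3 : (c i - c i') * Θ i' ≤ (P' - ∑ j, p i' j * t j) * Θ i' :=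
        mul_le_mul_of_nonneg_right (by linarith) hΘ0
      refine le_of_mul_le_mul_left ?_ hd
      linarith
    rw [hθ]
    split_ifs with h
    · exact max_le hP (Finset.sup'_le _ _ fun i' hi' => key i' (by simpa using hi'))
    · exact hP
end

section
/- Fix a principal-agent instance with n actions and m outcomes whose rewards are nondecreasing (r j ≤ r j' whenever j ≤ j'), an action i*, and a finite nonempty set τ of monotone contracts that is consistent with respect to i* with common expected payment P = T i* t for all t ∈ τ, where P ≥ 0, and that incentivizes i*. Then there exists a finite set τ' of contracts with cardinality at most min(m, n-1) such that: every t ∈ τ' is a step contract; T i* t = P for every t ∈ τ'; and for every action i ≠ i* there exists t ∈ τ' with U i t ≤ P - c i*. Consequently τ' is a monotone ambiguous contract consistent with respect to i* with the same expected payment P that incentivizes i*. -/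
theorem step_decomp (m : ℕ) : ∀ (t : Fin m → ℝ), (∀ j, 0 ≤ t j) → Monotone t →
    ∃ d : Fin m → ℝ, (∀ k, 0 ≤ d k) ∧ ∀ j, t j = ∑ k, d k * (if k ≤ j then 1 else 0) := by
  induction m with
  | zero => intro t _ _; exact ⟨t, fun k => k.elim0, fun k => k.elim0⟩
  | succ m ih =>
    intro t ht hm
    obtain ⟨d, hd, he⟩ := ih (fun j => t j.succ - t 0)
      (fun j => sub_nonneg.2 (hm (Fin.zero_le _)))
      (fun a b hab => sub_le_sub_right (hm (Fin.succ_le_succ_iff.2 hab)) _)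
    refine ⟨Fin.cons (t 0) d, ?_, ?_⟩
    · intro k
      refine Fin.cases ?_ (fun k => ?_) k
      · simpa using ht 0
      · simpa using hd k
    · intro j
      refine Fin.cases ?_ (fun j => ?_) j
      · rw [Fin.sum_univ_succ]; simp
      · have := he j
        rw [Fin.sum_univ_succ]
        simp only [Fin.cons_zero, Fin.cons_succ, Fin.zero_le, if_true, Fin.succ_le_succ_iff]
        linarith

theorem step_exchange (m : ℕ) (d q : Fin m → ℝ) (t : Fin m → ℝ)
    (he : ∀ j, t j = ∑ k, d k * (if k ≤ j then 1 else 0)) :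
    ∑ j, q j * t j = ∑ k, d k * ∑ j, q j * (if k ≤ j then 1 else 0) := by
  simp_rw [he, Finset.mul_sum]
  rw [Finset.sum_comm]
  refine Finset.sum_congr rfl fun k _ => Finset.sum_congr rfl fun j _ => by ring

theorem step_key (m : ℕ) (q s t : Fin m → ℝ) (hq : ∀ j, 0 ≤ q j) (hs : ∀ j, 0 ≤ s j)
    (hs1 : ∑ j, s j = 1) (ht : ∀ j, 0 ≤ t j) (hm : Monotone t) :
    ∃ k : Fin m, 0 < ∑ j, s j * (if k ≤ j then 1 else 0) ∧
      (∑ j, s j * t j) * (∑ j, q j * (if k ≤ j then 1 else 0)) ≤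
      (∑ j, q j * t j) * (∑ j, s j * (if k ≤ j then 1 else 0)) := by
  obtain ⟨d, hd, he⟩ := step_decomp m t ht hm
  have nn : ∀ (w : Fin m → ℝ), (∀ j, 0 ≤ w j) → ∀ k : Fin m,
      0 ≤ ∑ j, w j * (if k ≤ j then (1:ℝ) else 0) := by
    intro w hw k
    exact Finset.sum_nonneg fun j _ => mul_nonneg (hw j) (by split_ifs <;> norm_num)
  by_contra! hcon
  have hT := step_exchange m d q t he
  have hS := step_exchange m d s t he
  set T := ∑ j, q j * t j with hTd
  set P := ∑ j, s j * t j with hPd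
  have hP0 : 0 ≤ P := Finset.sum_nonneg fun j _ => mul_nonneg (hs j) (ht j)
  have hT0 : 0 ≤ T := Finset.sum_nonneg fun j _ => mul_nonneg (hq j) (ht j)
  rcases hP0.eq_or_lt with h0 | hpos
  · cases m with
    | zero => simp at hs1
    | succ m =>
      have := hcon 0 (by simp [hs1])
      rw [← h0] at this
      simp [hs1] at this
      linarith
  · obtain ⟨k, _, hk⟩ : ∃ k ∈ Finset.univ, 0 < d k * ∑ j, s j * (if k ≤ j then (1:ℝ) else 0) := by
      by_contra! h
      have := Finset.sum_nonpos h
      linarith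
    have hsk : 0 < ∑ j, s j * (if k ≤ j then (1:ℝ) else 0) :=
      pos_of_mul_pos_right hk (hd k)
    have hdk : 0 < d k := pos_of_mul_pos_left hk hsk.le
    have : ∑ k, d k * (T * ∑ j, s j * (if k ≤ j then (1:ℝ) else 0)) <
        ∑ k, d k * (P * ∑ j, q j * (if k ≤ j then (1:ℝ) else 0)) := by
      refine Finset.sum_lt_sum ?_ ⟨k, Finset.mem_univ _, mul_lt_mul_of_pos_left (hcon k hsk) hdk⟩
      intro l _
      refine mul_le_mul_of_nonneg_left ?_ (hd l)
      rcases (nn s hs l).eq_or_lt with h | h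
      · rw [← h, mul_zero]; exact mul_nonneg hpos.le (nn q hq l)
      · exact (hcon l h).le
    simp_rw [mul_left_comm (d _)] at this
    rw [← Finset.mul_sum, ← Finset.mul_sum, ← hT, ← hS] at this
    linarith [mul_comm T P]


/-- Structure of optimal monotone ambiguous contracts: any consistent monotone
ambiguous contract incentivizing `istar` with expected payment `P` can be
replaced by at most `min m (n-1)` step contracts with the same expected payment
for `istar`, which again form a consistent incentivizing ambiguous contract. -/
theorem monotone_ambiguous_contract_wlog_step
    (n m : ℕ) (p : Fin n → Fin m → ℝ) (c : Fin n → ℝ) (r : Fin m → ℝ)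
    (hp : ∀ i j, 0 ≤ p i j) (hp1 : ∀ i, ∑ j, p i j = 1)
    (hc : ∀ i, 0 ≤ c i) (hr : ∀ j, 0 ≤ r j) (hrmono : Monotone r)
    (istar : Fin n)
    (τ : Finset (Fin m → ℝ)) (hτ : τ.Nonempty)
    (hτpos : ∀ t ∈ τ, ∀ j, 0 ≤ t j)
    (hτmono : ∀ t ∈ τ, Monotone t)
    (P : ℝ) (hP : 0 ≤ P)
    (hcons : ∀ t ∈ τ, ∑ j, p istar j * t j = P)
    (hinc : ∀ i : Fin n,
      τ.inf' hτ (fun t => (∑ j, p i j * t j) - c i) ≤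
        τ.inf' hτ (fun t => (∑ j, p istar j * t j) - c istar)) :
    ∃ τ' : Finset (Fin m → ℝ),
      τ'.card ≤ min m (n - 1) ∧
      (∀ t ∈ τ', ∃ (k : Fin m) (x : ℝ), 0 ≤ x ∧
        (∀ j : Fin m, j < k → t j = 0) ∧ (∀ j : Fin m, k ≤ j → t j = x)) ∧
      (∀ t ∈ τ', ∑ j, p istar j * t j = P) ∧
      (∀ i : Fin n, i ≠ istar →
        ∃ t ∈ τ', (∑ j, p i j * t j) - c i ≤ P - c istar) := by
  classical
  have key : ∀ i : Fin n, ∃ k : Fin m,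
      0 < ∑ j, p istar j * (if k ≤ j then (1:ℝ) else 0) ∧
      P / (∑ j, p istar j * (if k ≤ j then (1:ℝ) else 0)) *
        (∑ j, p i j * (if k ≤ j then (1:ℝ) else 0)) - c i ≤ P - c istar := by
    intro i
    obtain ⟨t, ht, hte⟩ := Finset.exists_mem_eq_inf' hτ (fun t => (∑ j, p i j * t j) - c i)
    have h1 := hinc i
    rw [hte] at h1
    have h2 := h1.trans (Finset.inf'_le _ ht)
    simp only [hcons t ht] at h2
    obtain ⟨k, hk, hle⟩ := step_key m (p i) (p istar) t (hp i) (hp istar) (hp1 istar)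
      (hτpos t ht) (hτmono t ht)
    rw [hcons t ht] at hle
    refine ⟨k, hk, ?_⟩
    rw [div_mul_eq_mul_div]
    have := (div_le_iff₀ hk).2 hle
    linarith
  choose κ hκ hle using key
  let f : Fin m → Fin m → ℝ := fun k j =>
    P / (∑ j, p istar j * (if k ≤ j then (1:ℝ) else 0)) * (if k ≤ j then (1:ℝ) else 0)
  have hf : ∀ i k, ∑ j, p i j * f k j = P / (∑ j, p istar j * (if k ≤ j then (1:ℝ) else 0)) *
        (∑ j, p i j * (if k ≤ j then (1:ℝ) else 0)) := by
    intro i k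
    rw [Finset.mul_sum]
    exact Finset.sum_congr rfl fun j _ => mul_left_comm _ _ _
  refine ⟨((Finset.univ.erase istar).image κ).image f, le_min ?_ ?_, ?_, ?_, ?_⟩
  · exact Finset.card_image_le.trans ((Finset.card_le_univ _).trans (by simp))
  · exact Finset.card_image_le.trans (Finset.card_image_le.trans (by simp))
  · intro t ht
    simp only [Finset.mem_image] at ht
    obtain ⟨_, ⟨i, _, rfl⟩, rfl⟩ := ht
    refine ⟨κ i, _, div_nonneg hP (hκ i).le, ?_, ?_⟩
    · intro j hj
      simp [f, not_le.2 hj]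
    · intro j hj
      simp only [f, if_pos hj, mul_one]
  · intro t ht
    simp only [Finset.mem_image] at ht
    obtain ⟨_, ⟨i, _, rfl⟩, rfl⟩ := ht
    rw [hf, div_mul_cancel₀ _ (hκ i).ne']
  · intro i hi
    refine ⟨f (κ i), Finset.mem_image_of_mem _ (Finset.mem_image_of_mem _ (by simp [hi])), ?_⟩
    rw [hf]
    exact hle i
end

section
/- Fix a principal-agent instance and two actions i and i' with c i' < c i such that for every outcome j', ∑_{j ≥ j'} p i j ≤ ∑_{j ≥ j'} p i' j. Then for every monotone contract t (t j ≥ 0 for all j and t j ≤ t j' whenever j ≤ j'), U i t < U i' t. In particular, action i cannot be incentivized by any single monotone contract or by any ambiguous contract composed of monotone contracts. -/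
theorem abel_nonneg_aux : ∀ (m : ℕ) (q t : Fin m → ℝ),
    (∀ k : Fin m, 0 ≤ ∑ j, if k ≤ j then q j else 0) → (∀ j, 0 ≤ t j) → Monotone t →
    0 ≤ ∑ j, q j * t j := by
  intro m
  induction m with
  | zero => intro q t _ _ _; simp
  | succ m ih =>
    intro q t hq ht hm
    have h0 := hq 0
    simp only [Fin.zero_le, if_true] at h0
    have h1 := ih (fun j => q j.succ) (fun j => t j.succ - t 0) (fun k => by
        have := hq k.succ
        rw [Fin.sum_univ_succ] at this
        simpa [Fin.succ_le_succ_iff] using this)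
      (fun j => sub_nonneg.2 (hm (Fin.zero_le _)))
      (fun a b hab => sub_le_sub_right (hm (Fin.succ_le_succ_iff.2 hab)) _)
    have h2 := mul_nonneg h0 (ht 0)
    rw [Fin.sum_univ_succ, add_mul, Finset.sum_mul] at h2
    rw [Fin.sum_univ_succ]
    simp only [mul_sub, Finset.sum_sub_distrib] at h1
    linarith

/-- If a more costly action `i` is dominated by a cheaper action `i'` in all
upper-tail probabilities, then under every monotone contract the agent strictly
prefers `i'` to `i`; hence `i` cannot be incentivized by any (single or
ambiguous) monotone contract. -/
theorem tail_dominated_action_not_implementable_by_monotone_contract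
    (n m : ℕ) (p : Fin n → Fin m → ℝ) (c : Fin n → ℝ) (r : Fin m → ℝ)
    (hp : ∀ i j, 0 ≤ p i j) (hp1 : ∀ i, ∑ j, p i j = 1)
    (hc : ∀ i, 0 ≤ c i) (hr : ∀ j, 0 ≤ r j)
    (i i' : Fin n) (hcost : c i' < c i)
    (htail : ∀ j' : Fin m,
      ∑ j ∈ Finset.Ici j', p i j ≤ ∑ j ∈ Finset.Ici j', p i' j) :
    ∀ t : Fin m → ℝ, (∀ j, 0 ≤ t j) → Monotone t →
      (∑ j, p i j * t j) - c i < (∑ j, p i' j * t j) - c i' := by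
  intro t ht hm
  have h := abel_nonneg_aux m (fun j => p i' j - p i j) t (fun k => by
    have h := htail k
    rw [← Finset.sum_filter]
    have e : Finset.univ.filter (fun j => k ≤ j) = Finset.Ici k := by ext; simp
    rw [e, Finset.sum_sub_distrib]
    linarith) ht hm
  simp only [sub_mul, Finset.sum_sub_distrib] at h
  linarith
end

section
/- Fix a principal-agent instance with pairwise distinct costs that satisfies MLRP, an action i*, and a finite nonempty set τ of contracts that is consistent with respect to i* with common expected payment P ≥ 0 and incentivizes i*. Let ℓ be the least outcome j with p i* j > 0 and h the greatest outcome j with p i* j > 0. Define the single-outcome-payment contracts t¹ (paying P / p i* ℓ on outcome ℓ and 0 elsewhere) and t² (paying P / p i* h on outcome h and 0 elsewhere). Then T i* t¹ = T i* t² = P, and for every action i ≠ i*, min(U i t¹, U i t²) ≤ P - c i*; that is, the two-contract ambiguous contract {t¹, t²} is consistent with respect to i* and incentivizes i* with the same expected payment P. -/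
theorem exists_le_of_inf'_le {α : Type*} (s : Finset α) (hs : s.Nonempty) (f g : α → ℝ)
    (hfg : s.inf' hs f ≤ s.inf' hs g) : ∃ t ∈ s, f t ≤ g t := by
  obtain ⟨t, ht, h1⟩ := Finset.exists_mem_eq_inf' hs f
  exact ⟨t, ht, h1 ▸ hfg.trans (Finset.inf'_le g ht)⟩

/-- Under MLRP (with pairwise distinct costs), two SOP contracts suffice: the
SOP contracts paying on the least and greatest outcomes in the support of
`istar` form a consistent ambiguous contract incentivizing `istar` with the
same expected payment `P` as the given ambiguous contract `τ`. -/
theorem mlrp_two_SOP_contracts_suffice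
    (n m : ℕ) (p : Fin n → Fin m → ℝ) (c : Fin n → ℝ) (r : Fin m → ℝ)
    (hp : ∀ i j, 0 ≤ p i j) (hp1 : ∀ i, ∑ j, p i j = 1)
    (hc : ∀ i, 0 ≤ c i) (hr : ∀ j, 0 ≤ r j) (hrmono : Monotone r)
    (hcdist : ∀ i₁ i₂ : Fin n, i₁ ≠ i₂ → c i₁ ≠ c i₂)
    (hmlrp : ∀ i i' : Fin n, c i' < c i → ∀ j j' : Fin m, j < j' →
      p i j * p i' j' ≤ p i j' * p i' j)
    (istar : Fin n)
    (τ : Finset (Fin m → ℝ)) (hτ : τ.Nonempty)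
    (hτpos : ∀ t ∈ τ, ∀ j, 0 ≤ t j)
    (P : ℝ) (hP : 0 ≤ P)
    (hcons : ∀ t ∈ τ, ∑ j, p istar j * t j = P)
    (hinc : ∀ i : Fin n,
      τ.inf' hτ (fun t => (∑ j, p i j * t j) - c i) ≤
        τ.inf' hτ (fun t => (∑ j, p istar j * t j) - c istar))
    (ℓ h : Fin m)
    (hℓ : 0 < p istar ℓ ∧ ∀ j, 0 < p istar j → ℓ ≤ j)
    (hh : 0 < p istar h ∧ ∀ j, 0 < p istar j → j ≤ h) :
    (∑ j, p istar j * (if j = ℓ then P / p istar ℓ else 0) = P) ∧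
    (∑ j, p istar j * (if j = h then P / p istar h else 0) = P) ∧
    (∀ i : Fin n, i ≠ istar →
      min ((∑ j, p i j * (if j = ℓ then P / p istar ℓ else 0)) - c i)
          ((∑ j, p i j * (if j = h then P / p istar h else 0)) - c i)
        ≤ P - c istar) := by
  have key : ∀ (i : Fin n) (k : Fin m), 0 < p istar k →
      (∀ j, p i k * p istar j ≤ p i j * p istar k) →
      (∑ j, p i j * (if j = k then P / p istar k else 0)) - c i ≤ P - c istar := by
    intro i k hk hle
    obtain ⟨t, ht, h1⟩ := exists_le_of_inf'_le τ hτ _ _ (hinc i)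
    have h2 : (∑ j, p i j * t j) - c i ≤ P - c istar := by
      rw [← hcons t ht]
      exact h1
    have h3 : ∑ j, p i j * (if j = k then P / p istar k else 0) ≤ ∑ j, p i j * t j := by
      simp only [mul_ite, mul_zero, Finset.sum_ite_eq', Finset.mem_univ, if_true]
      rw [← mul_div_assoc, div_le_iff₀ hk, ← hcons t ht, Finset.mul_sum, Finset.sum_mul]
      apply Finset.sum_le_sum
      intro j _
      have := mul_le_mul_of_nonneg_right (hle j) (hτpos t ht j)
      linarith
    linarith
  have hz : ∀ j, ¬ 0 < p istar j → p istar j = 0 := fun j hj =>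
    le_antisymm (not_lt.mp hj) (hp istar j)
  refine ⟨?_, ?_, ?_⟩
  · simp only [mul_ite, mul_zero, Finset.sum_ite_eq', Finset.mem_univ, if_true]
    exact mul_div_cancel₀ P hℓ.1.ne'
  · simp only [mul_ite, mul_zero, Finset.sum_ite_eq', Finset.mem_univ, if_true]
    exact mul_div_cancel₀ P hh.1.ne'
  · intro i hi
    rcases lt_or_gt_of_ne (hcdist i istar hi) with hlt | hgt
    · refine (min_le_right _ _).trans (key i h hh.1 fun j => ?_)
      by_cases hj : 0 < p istar j
      · rcases (hh.2 j hj).eq_or_lt with e | l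
        · rw [e]
        · linarith [hmlrp istar i hlt j h l]
      · rw [hz j hj, mul_zero]
        exact mul_nonneg (hp i j) hh.1.le
    · refine (min_le_left _ _).trans (key i ℓ hℓ.1 fun j => ?_)
      by_cases hj : 0 < p istar j
      · rcases (hℓ.2 j hj).eq_or_lt with e | l
        · rw [e]
        · exact hmlrp i istar hgt ℓ j l
      · rw [hz j hj, mul_zero]
        exact mul_nonneg (hp i j) hℓ.1.le
end

section
/- Fix a principal-agent instance with pairwise distinct costs that satisfies MLRP, with nondecreasing rewards, an action i*, and a finite nonempty set τ of monotone contracts that is consistent with respect to i* with common expected payment P ≥ 0 and incentivizes i*. Let ℓ be the least outcome j with p i* j > 0 and h the greatest outcome j with p i* j > 0. Define the step contracts t¹ (with t¹ j = P for all j ≥ ℓ and 0 otherwise) and t² (with t² j = P / p i* h for all j ≥ h and 0 otherwise). Then T i* t¹ = T i* t² = P, and for every action i ≠ i*, min(U i t¹, U i t²) ≤ P - c i*; that is, the two-step-contract ambiguous contract {t¹, t²} is monotone, consistent with respect to i*, and incentivizes i* with the same expected payment P. -/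
/-- Under MLRP (with pairwise distinct costs), two step contracts suffice for
monotone ambiguous contracts: the step contracts starting at the least and
greatest outcomes in the support of `istar` form a consistent (monotone)
ambiguous contract incentivizing `istar` with the same expected payment `P`. -/
theorem mlrp_two_step_contracts_suffice
    (n m : ℕ) (p : Fin n → Fin m → ℝ) (c : Fin n → ℝ) (r : Fin m → ℝ)
    (hp : ∀ i j, 0 ≤ p i j) (hp1 : ∀ i, ∑ j, p i j = 1)
    (hc : ∀ i, 0 ≤ c i) (hr : ∀ j, 0 ≤ r j) (hrmono : Monotone r)
    (hcdist : ∀ i₁ i₂ : Fin n, i₁ ≠ i₂ → c i₁ ≠ c i₂)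
    (hmlrp : ∀ i i' : Fin n, c i' < c i → ∀ j j' : Fin m, j < j' →
      p i j * p i' j' ≤ p i j' * p i' j)
    (istar : Fin n)
    (τ : Finset (Fin m → ℝ)) (hτ : τ.Nonempty)
    (hτpos : ∀ t ∈ τ, ∀ j, 0 ≤ t j)
    (hτmono : ∀ t ∈ τ, Monotone t)
    (P : ℝ) (hP : 0 ≤ P)
    (hcons : ∀ t ∈ τ, ∑ j, p istar j * t j = P)
    (hinc : ∀ i : Fin n,
      τ.inf' hτ (fun t => (∑ j, p i j * t j) - c i) ≤
        τ.inf' hτ (fun t => (∑ j, p istar j * t j) - c istar))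
    (ℓ h : Fin m)
    (hℓ : 0 < p istar ℓ ∧ ∀ j, 0 < p istar j → ℓ ≤ j)
    (hh : 0 < p istar h ∧ ∀ j, 0 < p istar j → j ≤ h) :
    (∑ j, p istar j * (if ℓ ≤ j then P else 0) = P) ∧
    (∑ j, p istar j * (if h ≤ j then P / p istar h else 0) = P) ∧
    (∀ i : Fin n, i ≠ istar →
      min ((∑ j, p i j * (if ℓ ≤ j then P else 0)) - c i)
          ((∑ j, p i j * (if h ≤ j then P / p istar h else 0)) - c i)
        ≤ P - c istar) := by
  have hz : ∀ j, h < j → p istar j = 0 := fun j hj => by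
    by_contra hne
    exact absurd (hh.2 j (lt_of_le_of_ne (hp _ _) (Ne.symm hne))) (not_le.mpr hj)
  refine ⟨?_, ?_, ?_⟩
  · have : ∀ j, p istar j * (if ℓ ≤ j then P else 0) = p istar j * P := fun j => by
      by_cases hj : 0 < p istar j
      · rw [if_pos (hℓ.2 j hj)]
      · have : p istar j = 0 := le_antisymm (not_lt.mp hj) (hp _ _)
        simp [this]
    rw [Finset.sum_congr rfl (fun j _ => this j), ← Finset.sum_mul, hp1, one_mul]
  · rw [Finset.sum_eq_single h]
    · rw [if_pos le_rfl]
      have := hh.1.ne'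
      field_simp
    · intro j _ hj
      rcases lt_or_gt_of_ne hj with h1 | h1
      · simp [not_le.mpr h1]
      · simp [hz j h1]
    · simp
  · intro i hi
    rcases lt_or_gt_of_ne (hcdist i istar hi) with hlt | hgt
    · apply min_le_of_right_le
      have hz' : ∀ j, h < j → p i j = 0 := fun j hj => by
        have h1 := hmlrp istar i hlt h j hj
        rw [hz j hj, zero_mul] at h1
        have h2 := hp i j
        by_contra hne
        have : 0 < p i j := lt_of_le_of_ne h2 (Ne.symm hne)
        have := mul_pos hh.1 this
        linarith
      have hs : ∑ j, p i j * (if h ≤ j then P / p istar h else 0)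
          = p i h * (P / p istar h) := by
        rw [Finset.sum_eq_single h]
        · rw [if_pos le_rfl]
        · intro j _ hj
          rcases lt_or_gt_of_ne hj with h1 | h1
          · simp [not_le.mpr h1]
          · simp [hz' j h1]
        · simp
      obtain ⟨t, ht, hte⟩ := Finset.exists_mem_eq_inf' hτ
        (fun t => (∑ j, p i j * t j) - c i)
      have h1 := hinc i
      rw [hte] at h1
      have h2 := h1.trans (Finset.inf'_le _ ht)
      simp only [hcons t ht] at h2
      have key : ∀ j, p i h * p istar j ≤ p istar h * p i j := fun j => by
        rcases lt_trichotomy j h with hj | hj | hj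
        · have := hmlrp istar i hlt j h hj
          linarith
        · subst hj; linarith
        · rw [hz j hj, hz' j hj]; simp
      have h3 : p i h * P ≤ p istar h * ∑ j, p i j * t j := by
        rw [← hcons t ht, Finset.mul_sum, Finset.mul_sum]
        refine Finset.sum_le_sum fun j _ => ?_
        have := mul_le_mul_of_nonneg_right (key j) (hτpos t ht j)
        linarith
      have h4 : p i h * (P / p istar h) ≤ ∑ j, p i j * t j := by
        rw [← mul_div_assoc, div_le_iff₀ hh.1]
        linarith
      rw [hs]
      linarith
    · apply min_le_of_left_le
      have : ∑ j, p i j * (if ℓ ≤ j then P else 0) ≤ ∑ j, p i j * P := by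
        refine Finset.sum_le_sum fun j _ => mul_le_mul_of_nonneg_left ?_ (hp i j)
        split_ifs
        · exact le_rfl
        · exact hP
      rw [← Finset.sum_mul, hp1, one_mul] at this
      linarith
end

section
/- Fix a principal-agent instance with two effort levels: there exist reals 0 ≤ c_lo < c_hi such that every action's cost is either c_lo or c_hi; assume the rewards satisfy r 0 = 0 and are nondecreasing, and assume max_i (R i - c i) ≥ 0 where R i = ∑_j p i j * r j. Then there exist a contract t (t j ≥ 0 for all j) and an action i such that U i t ≥ 0, U i t ≥ U i' t for every action i', and R i - T i t ≥ (1/2) * max_{i'} (R i' - c i'). In other words, for instances with two effort levels the gap between the maximum expected welfare (first best) and the best principal utility achievable by a single contract (second best) is at most 2. -/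
/-- For instances with two effort levels, the gap between the first best (the
maximum expected welfare) and the second best (the best principal utility
achievable by a single contract) is at most 2. -/
theorem two_effort_levels_first_best_at_most_twice_second_best
    (n m : ℕ) (hm : 0 < m)
    (p : Fin n → Fin m → ℝ) (c : Fin n → ℝ) (r : Fin m → ℝ)
    (hp : ∀ i j, 0 ≤ p i j) (hp1 : ∀ i, ∑ j, p i j = 1)
    (hc : ∀ i, 0 ≤ c i) (hr : ∀ j, 0 ≤ r j)
    (c_lo c_hi : ℝ) (hclo : 0 ≤ c_lo) (hlohi : c_lo < c_hi)
    (htwo : ∀ i : Fin n, c i = c_lo ∨ c i = c_hi)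
    (hr0 : r ⟨0, hm⟩ = 0) (hrmono : Monotone r)
    (hW : ∃ i : Fin n, 0 ≤ (∑ j, p i j * r j) - c i) :
    ∃ (t : Fin m → ℝ) (i : Fin n),
      (∀ j, 0 ≤ t j) ∧
      0 ≤ (∑ j, p i j * t j) - c i ∧
      (∀ i' : Fin n, (∑ j, p i' j * t j) - c i' ≤ (∑ j, p i j * t j) - c i) ∧
      (∀ i' : Fin n,
        (∑ j, p i' j * r j) - c i' ≤
          2 * ((∑ j, p i j * r j) - (∑ j, p i j * t j))) := by
  obtain ⟨i0, hi0⟩ := hW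
  obtain ⟨k, -, hk⟩ := Finset.exists_max_image Finset.univ
    (fun i : Fin n => (∑ j, p i j * r j) - c i) ⟨i0, Finset.mem_univ _⟩
  obtain ⟨R, hR⟩ : ∃ R : Fin n → ℝ, ∀ i, ∑ j, p i j * r j = R i := ⟨_, fun _ => rfl⟩
  simp only [hR, Finset.mem_univ, true_implies] at hk hi0 ⊢
  have hT : ∀ (α b : ℝ) (i : Fin n), ∑ j, p i j * (α * r j + b) = α * R i + b := by
    intro α b i
    have h : ∀ j, p i j * (α * r j + b) = α * (p i j * r j) + p i j * b := fun j => by ring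
    simp only [h, Finset.sum_add_distrib, ← Finset.mul_sum, ← Finset.sum_mul, hR, hp1, one_mul]
  have hW0 : 0 ≤ R k - c k := hi0.trans (hk i0)
  by_cases hl : ∃ l, c l = c_lo ∧ (R k - c k) / 2 ≤ R l - c_lo
  · obtain ⟨l, hl1, hl2⟩ := hl
    refine ⟨fun j => 0 * r j + c_lo, l, ?_, ?_, ?_, ?_⟩
    · intro j; simpa using hclo
    · simp only [hT]; linarith
    · intro i'; simp only [hT]
      rcases htwo i' with h | h <;> linarith
    · intro i'; simp only [hT]
      have := hk i'
      linarith
  · push Not at hl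
    have hck : c k = c_hi := by
      rcases htwo k with h | h
      · have := hl k h
        rw [h] at this hW0
        linarith
      · exact h
    rw [hck] at hW0 hl
    obtain ⟨d, hd⟩ : ∃ d, d = c_hi - c_lo := ⟨_, rfl⟩
    obtain ⟨D, hD⟩ : ∃ D, D = (R k - c_hi) / 2 + d := ⟨_, rfl⟩
    have hd0 : 0 < d := by linarith
    have hD0 : 0 < D := by linarith
    obtain ⟨α, hα⟩ : ∃ α, α = d / D := ⟨_, rfl⟩
    have hα0 : 0 ≤ α := by rw [hα]; positivity
    have hαD : α * D = d := by rw [hα]; field_simp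
    have hα1 : α ≤ 1 := by rw [hα, div_le_one hD0]; linarith
    obtain ⟨b, hb⟩ : ∃ b, b = max 0 (c_hi - α * R k) := ⟨_, rfl⟩
    have hb0 : 0 ≤ b := hb ▸ le_max_left _ _
    have hb1 : c_hi - α * R k ≤ b := hb ▸ le_max_right _ _
    refine ⟨fun j => α * r j + b, k, ?_, ?_, ?_, ?_⟩
    · intro j
      have := mul_nonneg hα0 (hr j)
      linarith
    · simp only [hT]; linarith
    · intro i'; simp only [hT]
      rcases htwo i' with h | h
      · have h1 := hl i' h
        have h2 : D ≤ R k - R i' := by linarith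
        have := mul_le_mul_of_nonneg_left h2 hα0
        linarith
      · have h1 := hk i'
        have h2 : R i' ≤ R k := by linarith
        have := mul_le_mul_of_nonneg_left h2 hα0
        linarith
    · intro i'; simp only [hT]
      have h1 := hk i'
      rcases max_choice 0 (c_hi - α * R k) with h | h
      · have h2 : D ≤ R k := by linarith
        have := mul_le_mul_of_nonneg_left h2 (sub_nonneg.2 hα1)
        linarith
      · linarith
end

section
/- For every ε with 0 < ε < 1 there exists a principal-agent instance with two effort levels (all costs equal to one of two values 0 ≤ c_lo < c_hi), with rewards r 0 = 0 nondecreasing, together with an action i, a finite set τ of contracts that is consistent with respect to i, incentivizes i, and satisfies min_{t ∈ τ} U i t ≥ 0, and a real u₀ > 0, such that: (a) for every contract t and every action i'' with U i'' t ≥ 0 and U i'' t ≥ U i' t for all i', the principal's utility satisfies R i'' - T i'' t ≤ u₀; and (b) R i - T i τ ≥ (2 - ε) * u₀, where T i τ is the common expected payment of action i under τ. Hence the ambiguity gap of instances with two effort levels is at least 2 - ε. -/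
/-- Tightness of the ambiguity-gap bound for two effort levels: for every
`0 < ε < 1` there is a two-effort-level instance in which an ambiguous contract
incentivizing some action yields the principal at least `2 - ε` times the
utility achievable by any single contract. -/
theorem two_effort_levels_ambiguity_gap_at_least_two_sub_eps :
    ∀ ε : ℝ, 0 < ε → ε < 1 →
    ∃ (n m : ℕ) (hm : 0 < m)
      (p : Fin n → Fin m → ℝ) (c : Fin n → ℝ) (r : Fin m → ℝ)
      (c_lo c_hi : ℝ) (i : Fin n)
      (τ : Finset (Fin m → ℝ)) (hτ : τ.Nonempty) (P u₀ : ℝ),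
      (∀ i' j, 0 ≤ p i' j) ∧ (∀ i', ∑ j, p i' j = 1) ∧ (∀ i', 0 ≤ c i') ∧
      0 ≤ c_lo ∧ c_lo < c_hi ∧ (∀ i' : Fin n, c i' = c_lo ∨ c i' = c_hi) ∧
      (∀ j, 0 ≤ r j) ∧ Monotone r ∧ r ⟨0, hm⟩ = 0 ∧
      (∀ t ∈ τ, ∀ j, 0 ≤ t j) ∧
      -- τ is consistent w.r.t. i with common expected payment P
      (∀ t ∈ τ, ∑ j, p i j * t j = P) ∧
      -- τ incentivizes i
      (∀ i' : Fin n,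
        τ.inf' hτ (fun t => (∑ j, p i' j * t j) - c i') ≤
          τ.inf' hτ (fun t => (∑ j, p i j * t j) - c i)) ∧
      -- individual rationality of i under τ
      0 ≤ τ.inf' hτ (fun t => (∑ j, p i j * t j) - c i) ∧
      0 < u₀ ∧
      -- (a) no single contract gives the principal more than u₀
      (∀ t : Fin m → ℝ, (∀ j, 0 ≤ t j) →
        ∀ i'' : Fin n,
          0 ≤ (∑ j, p i'' j * t j) - c i'' →
          (∀ i' : Fin n, (∑ j, p i' j * t j) - c i' ≤ (∑ j, p i'' j * t j) - c i'') →
          (∑ j, p i'' j * r j) - (∑ j, p i'' j * t j) ≤ u₀) ∧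
      -- (b) the ambiguous contract gives the principal at least (2 - ε) * u₀
      (2 - ε) * u₀ ≤ (∑ j, p i j * r j) - P := by
  intro ε h0 h1
  have hA : (0:ℝ) < 1 + ε := by linarith
  have hB : (0:ℝ) < 2 + ε := by linarith
  obtain ⟨q, hq⟩ : ∃ q : ℝ, q = ε / 2 / (1 + ε) := ⟨_, rfl⟩
  have hqR : q * (1 + ε) = ε / 2 := by rw [hq]; field_simp
  have hq0 : 0 < q := by rw [hq]; positivity
  have hq1 : q < 1 / 2 := by nlinarith
  obtain ⟨w, hw⟩ : ∃ w : ℝ, w = ε * (1 + ε) / (2 + ε) := ⟨_, rfl⟩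
  have hwR : w * (2 + ε) = ε * (1 + ε) := by rw [hw]; field_simp
  have hw0 : 0 < w := by rw [hw]; positivity
  have hww : ε / 2 ≤ w := by nlinarith
  refine ⟨3, 3, by norm_num, ![![0, 1/2, 1/2], ![1-q, q, 0], ![1-q, 0, q]], ![1, 0, 0],
    ![0, 1+ε, 1+ε], 0, 1, 0, {![0,2,0], ![0,0,2]}, by simp, 1, w,
    ?_, ?_, ?_, le_rfl, one_pos, ?_, ?_, ?_, rfl, ?_, ?_, ?_, ?_, hw0, ?_, ?_⟩
  · intro a b
    fin_cases a <;> fin_cases b <;> simp <;> linarith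
  · intro a
    fin_cases a <;> simp [Fin.sum_univ_three] <;> norm_num
  · intro a
    fin_cases a <;> simp
  · intro a
    fin_cases a <;> simp
  · intro a
    fin_cases a <;> simp <;> linarith
  · intro a b hab
    fin_cases a <;> fin_cases b <;> simp at hab ⊢ <;> linarith
  · intro t ht b
    simp only [Finset.mem_insert, Finset.mem_singleton] at ht
    rcases ht with rfl | rfl <;> fin_cases b <;> simp
  · intro t ht
    simp only [Finset.mem_insert, Finset.mem_singleton] at ht
    rcases ht with rfl | rfl <;> simp [Fin.sum_univ_three]
  · intro a
    refine Finset.le_inf' _ _ ?_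
    intro t ht
    have e : (∑ j, (![![0, 1/2, 1/2], ![1-q, q, 0], ![1-q, 0, q]] : Fin 3 → Fin 3 → ℝ) 0 j * t j)
        - (![1, 0, 0] : Fin 3 → ℝ) 0 = 0 := by
      simp only [Finset.mem_insert, Finset.mem_singleton] at ht
      rcases ht with rfl | rfl <;> simp [Fin.sum_univ_three]
    rw [e, Finset.inf'_le_iff]
    fin_cases a <;> simp [Fin.sum_univ_three]
  · refine Finset.le_inf' _ _ ?_
    intro t ht
    simp only [Finset.mem_insert, Finset.mem_singleton] at ht
    rcases ht with rfl | rfl <;> simp [Fin.sum_univ_three]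
  · intro t ht a hir hic
    have t0 := ht 0
    have t1 := ht 1
    have t2 := ht 2
    fin_cases a
    · have k1 := hic 1
      have k2 := hic 2
      simp [Fin.sum_univ_three] at k1 k2 ⊢
      have hS : (1 - q) * ((t 1 + t 2) / 2) ≥ 1 := by nlinarith
      have hS2 : (2 + ε) * ((t 1 + t 2) / 2) ≥ 2 * (1 + ε) := by
        have e : (2 + ε) = 2 * (1 + ε) * (1 - q) := by linarith
        rw [e]; nlinarith
      nlinarith
    · simp [Fin.sum_univ_three]
      nlinarith [mul_nonneg hq0.le t1, mul_nonneg (by linarith : 0 ≤ 1 - q) t0]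
    · simp [Fin.sum_univ_three]
      nlinarith [mul_nonneg hq0.le t2, mul_nonneg (by linarith : 0 ≤ 1 - q) t0]
  · simp [Fin.sum_univ_three]
    nlinarith
end

section
/- For every real z ≥ 1 there exists a principal-agent instance, an action i, a finite set τ of contracts that is consistent with respect to i, incentivizes i, and satisfies min_{t ∈ τ} U i t ≥ 0, and a real u₀ > 0, such that: (a) for every single contract t and every action i'' with U i'' t ≥ 0 and U i'' t ≥ U i' t for all actions i', the principal's utility satisfies R i'' - T i'' t ≤ u₀; and (b) R i - T i τ ≥ z * u₀, where T i τ is the common expected payment of action i under τ. Hence the ambiguity gap can be arbitrarily large. -/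
noncomputable def agP (N x : ℕ) : Fin 3 → ℝ :=
  if x = 2 * N then ![0, 1/2, 1/2]
  else if x % 2 = 0 then ![1 - 2^(x/2) / 2^N, 2^(x/2) / 2^N, 0]
  else ![1 - 2^(x/2) / 2^N, 0, 2^(x/2) / 2^N]

noncomputable def agC (x : ℕ) : ℝ := 2^(x/2) - ((x/2 : ℕ) : ℝ) - 1

lemma agC_nonneg (x : ℕ) : 0 ≤ agC x := by
  unfold agC
  have h : x/2 + 1 ≤ 2^(x/2) := Nat.lt_two_pow_self
  have h' : ((x/2 : ℕ) : ℝ) + 1 ≤ 2^(x/2) := by exact_mod_cast h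
  linarith

lemma agA_le (N x : ℕ) (hx : x < 2 * N + 1) : (2:ℝ)^(x/2) / 2^N ≤ 1 := by
  rw [div_le_one (by positivity)]
  exact pow_le_pow_right₀ (by norm_num) (by omega)

lemma agP_nonneg (N x : ℕ) (hx : x < 2 * N + 1) (j : Fin 3) : 0 ≤ agP N x j := by
  have h := agA_le N x hx
  have h0 : (0:ℝ) ≤ 2^(x/2) / 2^N := by positivity
  unfold agP
  split_ifs <;> fin_cases j <;> simp <;> first | exact h | positivity

lemma agP_sum (N x : ℕ) : ∑ j, agP N x j = 1 := by
  unfold agP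
  split_ifs <;> simp [Fin.sum_univ_three] <;> norm_num

lemma agP_R (N x : ℕ) (hx : x < 2 * N + 1) :
    ∑ j, agP N x j * (![0, 2^N, 2^N] : Fin 3 → ℝ) j = 2^(x/2) := by
  unfold agP
  split_ifs with h
  · subst h
    simp [Fin.sum_univ_three]
    ring
  · simp [Fin.sum_univ_three]
  · simp [Fin.sum_univ_three]

lemma agP_even (N j : ℕ) (h : j < N) (t : Fin 3 → ℝ) :
    ∑ k, agP N (2*j) k * t k = (1 - 2^j/2^N) * t 0 + 2^j/2^N * t 1 := by
  unfold agP
  rw [if_neg (by omega), if_pos (by omega)]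
  simp [Fin.sum_univ_three]

lemma agP_odd (N j : ℕ) (h : j < N) (t : Fin 3 → ℝ) :
    ∑ k, agP N (2*j+1) k * t k = (1 - 2^j/2^N) * t 0 + 2^j/2^N * t 2 := by
  unfold agP
  rw [if_neg (by omega), if_neg (by omega)]
  have : (2*j+1)/2 = j := by omega
  simp [Fin.sum_univ_three, this]

lemma agP_top (N : ℕ) (t : Fin 3 → ℝ) :
    ∑ k, agP N (2*N) k * t k = 1/2 * t 1 + 1/2 * t 2 := by
  unfold agP
  rw [if_pos rfl]
  simp [Fin.sum_univ_three]

lemma ag_single (N x : ℕ) (hx : x < 2 * N + 1) (t : Fin 3 → ℝ) (ht : ∀ j, 0 ≤ t j)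
    (hic : ∀ y, y < 2 * N + 1 →
      (∑ j, agP N y j * t j) - agC y ≤ (∑ j, agP N x j * t j) - agC x) :
    (2:ℝ)^(x/2) - ∑ j, agP N x j * t j ≤ 2 := by
  have hT : 0 ≤ ∑ j, agP N x j * t j :=
    Finset.sum_nonneg fun j _ => mul_nonneg (agP_nonneg N x hx j) (ht j)
  rcases Nat.eq_zero_or_pos (x/2) with h0 | hpos
  · rw [h0]
    norm_num
    linarith
  obtain ⟨j, hj⟩ : ∃ j, x/2 = j + 1 := ⟨x/2 - 1, by omega⟩
  have hjN : j < N := by omega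
  have h1 := hic (2*j) (by omega)
  have h2 := hic (2*j+1) (by omega)
  rw [agP_even N j hjN] at h1
  rw [agP_odd N j hjN] at h2
  have e1 : (2*j)/2 = j := by omega
  have e2 : (2*j+1)/2 = j := by omega
  unfold agC at h1 h2
  rw [e1, hj] at h1
  rw [e2, hj] at h2
  rw [hj]
  rw [pow_succ] at *
  push_cast at h1 h2
  have t0 := ht 0
  have hx' : x = 2 * N ∨ (x = 2*(j+1) ∧ j + 1 < N) ∨ (x = 2*(j+1)+1 ∧ j+1 < N) := by omega
  rcases hx' with h | ⟨h, hlt⟩ | ⟨h, hlt⟩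
  · have hN : N = j + 1 := by omega
    rw [h, agP_top] at h1 h2 ⊢
    have hb : (2:ℝ)^j/2^N = 1/2 := by
      rw [hN, pow_succ]
      field_simp
    rw [hb] at h1 h2
    linarith
  · rw [h, agP_even N _ hlt] at h1 h2 ⊢
    simp only [pow_succ] at h1 h2 ⊢
    generalize (2:ℝ)^N = Q at *
    generalize (2:ℝ)^j = q at *
    have e : q * 2 / Q = 2 * (q / Q) := by ring
    simp only [e] at h1 h2 ⊢
    generalize q / Q = b at *
    nlinarith
  · rw [h, agP_odd N _ hlt] at h1 h2 ⊢
    simp only [pow_succ] at h1 h2 ⊢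
    generalize (2:ℝ)^N = Q at *
    generalize (2:ℝ)^j = q at *
    have e : q * 2 / Q = 2 * (q / Q) := by ring
    simp only [e] at h1 h2 ⊢
    generalize q / Q = b at *
    nlinarith

/-- The ambiguity gap can be arbitrarily large: for every `z ≥ 1` there is a
principal-agent instance in which an ambiguous contract incentivizing some
action yields the principal at least `z` times the utility achievable by any
single contract. -/
theorem ambiguity_gap_unbounded :
    ∀ z : ℝ, 1 ≤ z →
    ∃ (n m : ℕ)
      (p : Fin n → Fin m → ℝ) (c : Fin n → ℝ) (r : Fin m → ℝ)
      (i : Fin n) (τ : Finset (Fin m → ℝ)) (hτ : τ.Nonempty) (P u₀ : ℝ),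
      (∀ i' j, 0 ≤ p i' j) ∧ (∀ i', ∑ j, p i' j = 1) ∧
      (∀ i', 0 ≤ c i') ∧ (∀ j, 0 ≤ r j) ∧
      (∀ t ∈ τ, ∀ j, 0 ≤ t j) ∧
      -- τ is consistent w.r.t. i with common expected payment P
      (∀ t ∈ τ, ∑ j, p i j * t j = P) ∧
      -- τ incentivizes i
      (∀ i' : Fin n,
        τ.inf' hτ (fun t => (∑ j, p i' j * t j) - c i') ≤
          τ.inf' hτ (fun t => (∑ j, p i j * t j) - c i)) ∧
      -- individual rationality of i under τ
      0 ≤ τ.inf' hτ (fun t => (∑ j, p i j * t j) - c i) ∧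
      0 < u₀ ∧
      -- (a) no single contract gives the principal more than u₀
      (∀ t : Fin m → ℝ, (∀ j, 0 ≤ t j) →
        ∀ i'' : Fin n,
          0 ≤ (∑ j, p i'' j * t j) - c i'' →
          (∀ i' : Fin n, (∑ j, p i' j * t j) - c i' ≤ (∑ j, p i'' j * t j) - c i'') →
          (∑ j, p i'' j * r j) - (∑ j, p i'' j * t j) ≤ u₀) ∧
      -- (b) the ambiguous contract gives the principal at least z * u₀
      z * u₀ ≤ (∑ j, p i j * r j) - P := by
  intro z hz
  obtain ⟨N, hN⟩ := exists_nat_ge (2 * z)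
  classical
  set τ : Finset (Fin 3 → ℝ) := {![0, 2 * agC (2*N), 0], ![0, 0, 2 * agC (2*N)]} with hτd
  have hτ : τ.Nonempty := by simp [hτd]
  have hc := agC_nonneg (2*N)
  have hcons : ∀ t ∈ τ, ∑ j, agP N (2*N) j * t j = agC (2*N) := by
    intro t ht
    rw [agP_top]
    simp only [hτd, Finset.mem_insert, Finset.mem_singleton] at ht
    rcases ht with rfl | rfl <;> simp
  have hinf : 0 ≤ τ.inf' hτ (fun t => (∑ j, agP N (2*N) j * t j) - agC (2*N)) := by
    rw [Finset.le_inf'_iff]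
    intro t ht
    rw [hcons t ht, sub_self]
  refine ⟨2*N+1, 3, fun x => agP N x, fun x => agC x, ![0, 2^N, 2^N], ⟨2*N, by omega⟩, τ, hτ,
    agC (2*N), 2, fun x j => agP_nonneg N x x.2 j, fun x => agP_sum N x,
    fun x => agC_nonneg x, ?_, ?_, hcons, ?_, hinf, by norm_num, ?_, ?_⟩
  · intro j
    fin_cases j <;> simp
  · intro t ht j
    simp only [hτd, Finset.mem_insert, Finset.mem_singleton] at ht
    rcases ht with rfl | rfl <;> fin_cases j <;> simp [hc]
  · rintro ⟨x, hx⟩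
    have hcx := agC_nonneg x
    have hx' : x = 2 * N ∨ (x = 2*(x/2) ∧ x/2 < N) ∨ (x = 2*(x/2)+1 ∧ x/2 < N) := by omega
    rcases hx' with h | ⟨h, hlt⟩ | ⟨h, hlt⟩
    · subst h
      exact le_rfl
    · refine le_trans ?_ hinf
      refine (Finset.inf'_le _ (b := ![0, 0, 2 * agC (2*N)]) (by simp [hτd])).trans ?_
      have := agP_even N (x/2) hlt ![0, 0, 2 * agC (2*N)]
      rw [← h] at this
      simp only [this]
      simp [hcx]
    · refine le_trans ?_ hinf
      refine (Finset.inf'_le _ (b := ![0, 2 * agC (2*N), 0]) (by simp [hτd])).trans ?_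
      have := agP_odd N (x/2) hlt ![0, 2 * agC (2*N), 0]
      rw [← h] at this
      simp only [this]
      simp [hcx]
  · intro t ht x _ hic
    simp only [agP_R N x x.2]
    exact ag_single N x x.2 t ht fun y hy => hic ⟨y, hy⟩
  · simp only [agP_R N (2*N) (by omega)]
    unfold agC
    have e : 2*N/2 = N := by omega
    rw [e]
    linarith
end

section
/- Let m ≥ 2, let rewards satisfy 0 = r 1 < r 2 ≤ ... ≤ r m, and let 0 ≤ c_lo < c_hi and 0 ≤ W_lo < W_hi with W_lo + c_lo > 0. Consider the diagonal setting with m pseudo-actions of cost c_lo: action 1 has weight 1 on outcome 1 and 0 elsewhere; for 2 ≤ i ≤ m, action i has weight (W_lo + c_lo)/r i on outcome i, weight max(0, 1 - (W_lo + c_lo)/r i) on outcome 1, and 0 elsewhere (these nonnegative weight vectors need not sum to 1); and one additional action m+1 of cost c_hi whose weights form a probability distribution q (q j ≥ 0, ∑_j q j = 1) with expected reward ∑_j q j * r j = W_hi + c_hi. Define, for any contract t ≥ 0 and any action a with weight vector w and cost γ, the utility U a t = ∑_j w j * t j - γ. Then: (a) there exists a contract t with t j ≥ 0 for all j, ∑_j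 q j * t j ≥ c_hi, and U (m+1) t ≥ U i t for all i ∈ {1,...,m}; and (b) for every contract t̃ satisfying these conditions there exists a contract t also satisfying them with t 1 = 0, t j = (r j / r 2) * t 2 for all j ≥ 2, and ∑_j q j * t j ≤ ∑_j q j * t̃ j. -/
/-- In the diagonal setting with parameters `(c_lo, c_hi, W_lo, W_hi)`:
(a) the extra high-cost action (with distribution `q`) is implementable, and
(b) among contracts implementing it there is a weakly cheaper one with
`t 0 = 0` and `t j = (r j / r 1) * t 1` for all `j ≥ 1` (0-indexed outcomes,
so outcome `1` here is the second outcome). -/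
theorem diagonal_setting_high_action_implementable_and_linear_payment
    (m : ℕ) (hm : 2 ≤ m)
    (r : Fin m → ℝ) (c_lo c_hi W_lo W_hi : ℝ) (q : Fin m → ℝ)
    (hr0 : r ⟨0, by omega⟩ = 0) (hr1 : 0 < r ⟨1, by omega⟩) (hrmono : Monotone r)
    (hclo : 0 ≤ c_lo) (hchi : c_lo < c_hi)
    (hWlo : 0 ≤ W_lo) (hWhi : W_lo < W_hi) (hWc : 0 < W_lo + c_lo)
    (hq : ∀ j, 0 ≤ q j) (hq1 : ∑ j, q j = 1)
    (hqR : ∑ j, q j * r j = W_hi + c_hi)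
    (w : Fin m → Fin m → ℝ)
    (hw : ∀ i j : Fin m,
      w i j = if i = (⟨0, by omega⟩ : Fin m) then
          (if j = i then 1 else 0)
        else if j = i then (W_lo + c_lo) / r i
        else if j = (⟨0, by omega⟩ : Fin m) then max 0 (1 - (W_lo + c_lo) / r i)
        else 0) :
    -- (a) the high-cost action is implementable (with individual rationality):
    (∃ t : Fin m → ℝ, (∀ j, 0 ≤ t j) ∧
        c_hi ≤ ∑ j, q j * t j ∧
        (∀ i : Fin m, (∑ j, w i j * t j) - c_lo ≤ (∑ j, q j * t j) - c_hi)) ∧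
    -- (b) any implementing contract can be replaced by a weakly cheaper
    -- implementing contract of the prescribed linear-in-rewards form:
    (∀ t' : Fin m → ℝ, (∀ j, 0 ≤ t' j) →
        c_hi ≤ ∑ j, q j * t' j →
        (∀ i : Fin m, (∑ j, w i j * t' j) - c_lo ≤ (∑ j, q j * t' j) - c_hi) →
        ∃ t : Fin m → ℝ, (∀ j, 0 ≤ t j) ∧
          c_hi ≤ ∑ j, q j * t j ∧
          (∀ i : Fin m, (∑ j, w i j * t j) - c_lo ≤ (∑ j, q j * t j) - c_hi) ∧
          t ⟨0, by omega⟩ = 0 ∧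
          (∀ j : Fin m, (⟨1, by omega⟩ : Fin m) ≤ j →
            t j = (r j / r ⟨1, by omega⟩) * t ⟨1, by omega⟩) ∧
          (∑ j, q j * t j) ≤ ∑ j, q j * t' j) := by
  have hri : ∀ i : Fin m, i ≠ (⟨0, by omega⟩ : Fin m) → 0 < r i := by
    intro i hi
    refine lt_of_lt_of_le hr1 (hrmono ?_)
    have : i.val ≠ 0 := fun h => hi (Fin.ext h)
    show 1 ≤ i.val
    omega
  have hw0 : ∀ t : Fin m → ℝ,
      ∑ j, w (⟨0, by omega⟩ : Fin m) j * t j = t ⟨0, by omega⟩ := by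
    intro t
    simp [hw]
  have hwi : ∀ (t : Fin m → ℝ) (i : Fin m), i ≠ (⟨0, by omega⟩ : Fin m) →
      ∑ j, w i j * t j = (W_lo + c_lo) / r i * t i
        + max 0 (1 - (W_lo + c_lo) / r i) * t ⟨0, by omega⟩ := by
    intro t i hi
    have hne : ∀ j : Fin m, w i j * t j =
        (if j = i then (W_lo + c_lo) / r i * t j else 0) +
        (if j = (⟨0, by omega⟩ : Fin m) then
          max 0 (1 - (W_lo + c_lo) / r i) * t j else 0) := by
      intro j
      rw [hw, if_neg hi]
      by_cases h1 : j = i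
      · have h2 : j ≠ (⟨0, by omega⟩ : Fin m) := by rw [h1]; exact hi
        rw [if_pos h1, if_pos h1, if_neg h2, add_zero]
      · rw [if_neg h1, if_neg h1, zero_add, ite_mul, zero_mul]
    rw [Finset.sum_congr rfl (fun j _ => hne j), Finset.sum_add_distrib,
      Finset.sum_ite_eq' Finset.univ i, Finset.sum_ite_eq' Finset.univ]
    simp
  have hlin : ∀ a : ℝ, 0 ≤ a → c_hi ≤ a * (W_hi + c_hi) →
      a * (W_lo + c_lo) - c_lo ≤ a * (W_hi + c_hi) - c_hi →
      (∀ j, 0 ≤ a * r j) ∧ (∑ j, q j * (a * r j) = a * (W_hi + c_hi)) ∧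
      (∀ i : Fin m, (∑ j, w i j * (a * r j)) - c_lo ≤ (∑ j, q j * (a * r j)) - c_hi) := by
    intro a ha h1 h2
    have hs : ∑ j, q j * (a * r j) = a * (W_hi + c_hi) := by
      rw [← hqR, Finset.mul_sum]
      exact Finset.sum_congr rfl (fun j _ => by ring)
    refine ⟨fun j => ?_, hs, fun i => ?_⟩
    · by_cases hj : j = (⟨0, by omega⟩ : Fin m)
      · rw [hj, hr0, mul_zero]
      · exact mul_nonneg ha (hri j hj).le
    · rw [hs]
      by_cases hi : i = (⟨0, by omega⟩ : Fin m)
      · rw [hi, hw0 (fun j => a * r j)]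
        simp only [hr0]
        linarith
      · rw [hwi (fun j => a * r j) i hi]
        simp only [hr0]
        have : (W_lo + c_lo) / r i * (a * r i) = a * (W_lo + c_lo) := by
          have := (hri i hi).ne'
          field_simp
        rw [this]
        linarith
  refine ⟨?_, ?_⟩
  · obtain ⟨h1, h2, h3⟩ := hlin 1 zero_le_one (by linarith) (by linarith)
    exact ⟨fun j => 1 * r j, h1, by rw [h2]; linarith, h3⟩
  · intro t' ht hIR hIC
    set P := ∑ j, q j * t' j with hP
    set S := W_lo + c_lo with hS
    set R := W_hi + c_hi with hR
    set t0 := t' ⟨0, by omega⟩ with ht0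
    have hR0 : 0 < R := by linarith
    have ht00 : 0 ≤ t0 := ht _
    have key : ∀ i, S * t' i ≤ r i * (P - (c_hi - c_lo)) - (r i - S) * t0 := by
      intro i
      by_cases hi : i = (⟨0, by omega⟩ : Fin m)
      · rw [hi, hr0, ← ht0]; linarith
      · have h := hIC i
        rw [hwi t' i hi] at h
        have hp := hri i hi
        have hm1 : (1 - S / r i) * t0 ≤ max 0 (1 - S / r i) * t0 :=
          mul_le_mul_of_nonneg_right (le_max_right _ _) ht00
        have h3 : S / r i * t' i + (1 - S / r i) * t0 ≤ P - (c_hi - c_lo) := by linarith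
        have h4 := mul_le_mul_of_nonneg_left h3 hp.le
        have h5 : r i * (S / r i * t' i + (1 - S / r i) * t0) = S * t' i + (r i - S) * t0 := by
          field_simp
        linarith
    have hsum : S * P ≤ R * (P - (c_hi - c_lo)) - (R - S) * t0 := by
      have h := Finset.sum_le_sum
        (fun i (_ : i ∈ Finset.univ) => mul_le_mul_of_nonneg_left (key i) (hq i))
      have e1 : ∑ i, q i * (S * t' i) = S * P := by
        rw [hP, Finset.mul_sum]
        exact Finset.sum_congr rfl (fun j _ => by ring)
      have e2 : ∑ i, q i * (r i * (P - (c_hi - c_lo)) - (r i - S) * t0)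
          = R * (P - (c_hi - c_lo)) - (R - S) * t0 := by
        have : ∀ i, q i * (r i * (P - (c_hi - c_lo)) - (r i - S) * t0)
          = (q i * r i) * (P - (c_hi - c_lo) - t0) + q i * (S * t0) := fun i => by ring
        rw [Finset.sum_congr rfl (fun i _ => this i), Finset.sum_add_distrib,
          ← Finset.sum_mul, ← Finset.sum_mul, hqR, hq1]
        ring
      linarith
    have hRS : 0 ≤ (R - S) * t0 := mul_nonneg (by linarith) ht00
    have haR : P / R * R = P := div_mul_cancel₀ _ hR0.ne'
    obtain ⟨h1, h2, h3⟩ := hlin (P / R) (div_nonneg (by linarith) hR0.le)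
      (by rw [haR]; exact hIR) (by
        rw [haR]
        have : P / R * S ≤ P - (c_hi - c_lo) := by
          rw [div_mul_eq_mul_div, div_le_iff₀ hR0]
          linarith
        linarith)
    refine ⟨fun j => P / R * r j, h1, by rw [h2, haR]; exact hIR, h3, ?_, ?_, ?_⟩
    · simp [hr0]
    · intro j _
      have := hr1.ne'
      show P / R * r j = r j / r ⟨1, by omega⟩ * (P / R * r ⟨1, by omega⟩)
      field_simp
    · rw [h2, haR]
end

section
/- For every integer n ≥ 3 and every real B < n - 1 there exists a principal-agent instance with n actions and 4 outcomes (nondecreasing rewards, r 0 = 0, and an action of cost 0), an action i, a finite set τ of monotone contracts that is consistent with respect to i, incentivizes i, and satisfies min_{t ∈ τ} U i t ≥ 0, and a real u₀ > 0, such that: (a) for every monotone contract t and every action i'' with U i'' t ≥ 0 and U i'' t ≥ U i' t for all actions i', the principal's utility satisfies R i'' - T i'' t ≤ u₀; and (b) R i - T i τ ≥ B * u₀. Hence the class of monotone contracts is manipulable, and an ambiguous monotone contract can improve the principal's utility over every single monotone contract by a factor arbitrarily close to n - 1. -/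
noncomputable def amP (m : ℕ) (x : ℝ) (k : ℕ) : Fin 4 → ℝ :=
  if k < m then ![1 - x ^ (m - k), x ^ (m - k) - x ^ m, x ^ m, 0]
  else if k = m then ![0, 1 - x ^ m, x ^ m - x ^ m * x ^ m, x ^ m * x ^ m]
  else ![1 - x ^ m, x ^ m - x ^ m * x ^ m, 0, x ^ m * x ^ m]

noncomputable def amW (x y : ℝ) (k : ℕ) : ℝ := y ^ k - 1 - k * (1 - x)

noncomputable def amC (m : ℕ) (x y : ℝ) (k : ℕ) : ℝ :=
  if k ≤ m then amW x y k else amW x y m * x ^ m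

lemma amW_nonneg {x y : ℝ} (hx : 0 < x) (hx1 : x < 1) (hxy : x * y = 1) (k : ℕ) :
    0 ≤ amW x y k := by
  have hy : 1 < y := by nlinarith
  have h := one_add_mul_le_pow (a := y - 1) (by linarith) k
  have e : 1 + (y - 1) = y := by ring
  rw [e] at h
  have h2 : 1 - x ≤ y - 1 := by nlinarith [sq_nonneg (y - 1)]
  have h3 : (k : ℝ) * (1 - x) ≤ k * (y - 1) := mul_le_mul_of_nonneg_left h2 (by positivity)
  unfold amW
  linarith


/-- Monotone contracts are manipulable with a gap arbitrarily close to `n - 1`: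
for every `n ≥ 3` and `B < n - 1` there is an instance with `n` actions and `4`
outcomes where an ambiguous monotone contract beats every single monotone
contract by a factor of at least `B`. -/
theorem monotone_contracts_manipulable_gap :
    ∀ n : ℕ, 3 ≤ n → ∀ B : ℝ, B < (n : ℝ) - 1 →
    ∃ (p : Fin n → Fin 4 → ℝ) (c : Fin n → ℝ) (r : Fin 4 → ℝ)
      (i : Fin n) (τ : Finset (Fin 4 → ℝ)) (hτ : τ.Nonempty) (P u₀ : ℝ),
      (∀ i' j, 0 ≤ p i' j) ∧ (∀ i', ∑ j, p i' j = 1) ∧ (∀ i', 0 ≤ c i') ∧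
      (∀ j, 0 ≤ r j) ∧ Monotone r ∧ r 0 = 0 ∧ (∃ i₀ : Fin n, c i₀ = 0) ∧
      (∀ t ∈ τ, ∀ j, 0 ≤ t j) ∧ (∀ t ∈ τ, Monotone t) ∧
      -- τ is consistent w.r.t. i with common expected payment P
      (∀ t ∈ τ, ∑ j, p i j * t j = P) ∧
      -- τ incentivizes i
      (∀ i' : Fin n,
        τ.inf' hτ (fun t => (∑ j, p i' j * t j) - c i') ≤
          τ.inf' hτ (fun t => (∑ j, p i j * t j) - c i)) ∧
      -- individual rationality of i under τ
      0 ≤ τ.inf' hτ (fun t => (∑ j, p i j * t j) - c i) ∧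
      0 < u₀ ∧
      -- (a) no single monotone contract gives the principal more than u₀
      (∀ t : Fin 4 → ℝ, (∀ j, 0 ≤ t j) → Monotone t →
        ∀ i'' : Fin n,
          0 ≤ (∑ j, p i'' j * t j) - c i'' →
          (∀ i' : Fin n, (∑ j, p i' j * t j) - c i' ≤ (∑ j, p i'' j * t j) - c i'') →
          (∑ j, p i'' j * r j) - (∑ j, p i'' j * t j) ≤ u₀) ∧
      -- (b) the ambiguous monotone contract gives the principal at least B * u₀
      B * u₀ ≤ (∑ j, p i j * r j) - P := by
  intro n hn B hB
  obtain ⟨m, rfl⟩ : ∃ m, n = m + 2 := ⟨n - 2, by omega⟩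
  have hm : 1 ≤ m := by omega
  obtain ⟨x, hx, hx1, hxB⟩ : ∃ x : ℝ, 0 < x ∧ x < 1 ∧
      B * (1 + m * x) ≤ 1 + m * (1 - x) := by
    push_cast at hB
    have he : 0 < (m : ℝ) + 1 - B := by linarith
    have hM : 0 < (m : ℝ) * |B| + m + 1 := by positivity
    refine ⟨((m : ℝ) + 1 - B) / ((m : ℝ) * |B| + m + 1 + ((m : ℝ) + 1 - B)), by positivity, ?_, ?_⟩
    · rw [div_lt_one (by positivity)]; linarith
    · set x := ((m : ℝ) + 1 - B) / ((m : ℝ) * |B| + m + 1 + ((m : ℝ) + 1 - B)) with hxd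
      have hx : 0 < x := by positivity
      have h1 : x * ((m : ℝ) * |B| + m + 1 + ((m : ℝ) + 1 - B)) = (m : ℝ) + 1 - B := by
        rw [hxd]; field_simp
      have h2 : (m * x) * B ≤ (m * x) * |B| :=
        mul_le_mul_of_nonneg_left (le_abs_self B) (by positivity)
      nlinarith [mul_pos hx he]
  obtain ⟨y, hxy⟩ : ∃ y : ℝ, x * y = 1 := ⟨x⁻¹, by field_simp⟩
  have hy : 1 < y := by nlinarith
  have hD : 0 < x ^ m := by positivity
  have hD1 : x ^ m ≤ 1 := pow_le_one₀ hx.le hx1.le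
  have hDy : x ^ m * y ^ m = 1 := by rw [← mul_pow, hxy, one_pow]
  have hW := amW_nonneg hx hx1 hxy
  have hkm : ∀ k, k ≤ m → x ^ (m - k) * y ^ m = y ^ k := by
    intro k hk
    obtain ⟨l, rfl⟩ := Nat.exists_eq_add_of_le hk
    have : x ^ l * y ^ l = 1 := by rw [← mul_pow, hxy, one_pow]
    rw [Nat.add_sub_cancel_left, pow_add]
    linear_combination y ^ k * this
  have hT : ∀ t : Fin 4 → ℝ, ∑ j, amP m x m j * t j =
      (1 - x ^ m) * t 1 + (x ^ m - x ^ m * x ^ m) * t 2 + x ^ m * x ^ m * t 3 := by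
    intro t; simp [amP, Fin.sum_univ_four]
  have hC : ∀ k, k < m → ∀ t : Fin 4 → ℝ, ∑ j, amP m x k j * t j =
      (1 - x ^ (m - k)) * t 0 + (x ^ (m - k) - x ^ m) * t 1 + x ^ m * t 2 := by
    intro k hk t; simp [amP, Fin.sum_univ_four, hk]
  have hZ : ∀ t : Fin 4 → ℝ, ∑ j, amP m x (m + 1) j * t j =
      (1 - x ^ m) * t 0 + (x ^ m - x ^ m * x ^ m) * t 1 + x ^ m * x ^ m * t 3 := by
    intro t; simp [amP, Fin.sum_univ_four]
  have hcases : ∀ i : Fin (m + 2), i.val < m ∨ i.val = m ∨ i.val = m + 1 := by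
    intro i; omega
  have hcC : ∀ k, k ≤ m → amC m x y k = amW x y k := by
    intro k hk; simp [amC, hk]
  have hcZ : amC m x y (m + 1) = amW x y m * x ^ m := by simp [amC]
  set c := amW x y m with hc
  have hc0 : 0 ≤ c := hW m
  set t2 : Fin 4 → ℝ := ![0, 0, c * y ^ m, c * y ^ m] with ht2
  set t3 : Fin 4 → ℝ := ![0, 0, 0, c * y ^ m * y ^ m] with ht3
  have hy0 : 0 < y ^ m := by positivity
  have e2 : ∑ j, amP m x m j * t2 j = c := by
    rw [hT]; simp [ht2]; linear_combination c * hDy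
  have e3 : ∑ j, amP m x m j * t3 j = c := by
    rw [hT]; simp [ht3]; linear_combination c * (x ^ m * y ^ m + 1) * hDy
  have hinf : ∀ hτ : ({t2, t3} : Finset (Fin 4 → ℝ)).Nonempty,
      0 ≤ ({t2, t3} : Finset (Fin 4 → ℝ)).inf' hτ
        (fun t => (∑ j, amP m x m j * t j) - amC m x y m) := by
    intro hτ
    apply Finset.le_inf'
    intro t ht
    rw [hcC m le_rfl]
    simp only [Finset.mem_insert, Finset.mem_singleton] at ht
    rcases ht with rfl | rfl
    · rw [e2]; linarith
    · rw [e3]; linarith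
  refine ⟨fun i => amP m x i.val, fun i => amC m x y i.val, ![0, y ^ m, y ^ m, y ^ m],
    ⟨m, by omega⟩, {t2, t3}, by simp, c, 1 + m * x, ?_, ?_, ?_, ?_, ?_, ?_, ?_, ?_, ?_, ?_, ?_,
    hinf _, by positivity, ?_, ?_⟩
  · intro i j
    have hDD : x ^ m * x ^ m ≤ x ^ m := by nlinarith
    have hDD0 : 0 ≤ x ^ m * x ^ m := by positivity
    have h1 : x ^ (m - i.val) ≤ 1 := pow_le_one₀ hx.le hx1.le
    have h2 : x ^ m ≤ x ^ (m - i.val) := pow_le_pow_of_le_one hx.le hx1.le (by omega)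
    unfold amP
    dsimp only
    split_ifs <;> fin_cases j <;> simp <;> linarith
  · intro i
    dsimp only
    unfold amP
    split_ifs <;> simp [Fin.sum_univ_four]
  · intro i
    dsimp only
    unfold amC
    split_ifs
    · exact hW _
    · positivity
  · intro j; fin_cases j <;> simp <;> positivity
  · rw [Fin.monotone_iff_le_succ]
    intro j; fin_cases j <;> simp; positivity
  · rfl
  · exact ⟨⟨0, by omega⟩, by simp [amC, amW]⟩
  · intro t ht j
    simp only [Finset.mem_insert, Finset.mem_singleton] at ht
    rcases ht with rfl | rfl <;> fin_cases j <;> simp [ht2, ht3] <;> positivity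
  · intro t ht
    simp only [Finset.mem_insert, Finset.mem_singleton] at ht
    rw [Fin.monotone_iff_le_succ]
    intro j
    rcases ht with rfl | rfl <;> fin_cases j <;> simp [ht2, ht3] <;> positivity
  · intro t ht
    simp only [Finset.mem_insert, Finset.mem_singleton] at ht
    rcases ht with rfl | rfl
    · exact e2
    · exact e3
  · intro i
    refine le_trans ?_ (hinf _)
    dsimp only
    rcases hcases i with h | h | h
    · refine (Finset.inf'_le _ (b := t3) (by simp)).trans ?_
      rw [hC _ h, hcC _ h.le]
      simp [ht3]
      exact hW _
    · refine (Finset.inf'_le _ (b := t3) (by simp)).trans ?_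
      rw [h, e3, hcC _ le_rfl]
      linarith
    · refine (Finset.inf'_le _ (b := t2) (by simp)).trans ?_
      rw [h, hZ, hcZ]
      simp [ht2]
      apply le_of_eq
      linear_combination c * x ^ m * hDy
  · intro t ht0 htm i _ hi
    dsimp only at hi ⊢
    have h0 := ht0 0
    have h01 : t 0 ≤ t 1 := htm (by decide)
    have h12 : t 1 ≤ t 2 := htm (by decide)
    have h23 : t 2 ≤ t 3 := htm (by decide)
    have hmx : 0 ≤ (m : ℝ) * x := by positivity
    rcases hcases i with h | h | h
    · rcases Nat.eq_zero_or_pos i.val with hk0 | hk0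
      · rw [hC _ h, hC _ h, hk0]
        simp
        nlinarith [mul_nonneg hD.le (h0.trans (h01.trans h12))]
      · obtain ⟨l, hl⟩ : ∃ l, i.val = l + 1 := ⟨i.val - 1, by omega⟩
        have ha := hi ⟨l, by omega⟩
        dsimp only at ha
        rw [hl] at ha h
        rw [hl, hC _ h, hC _ h]
        rw [hC _ (by omega), hC _ h, hcC _ (by omega), hcC _ h.le] at ha
        have hq := hkm _ h.le
        have eq1 : x ^ (m - l) = x * x ^ (m - (l + 1)) := by
          rw [← pow_succ']; congr 1; omega
        have eq2 : y ^ l = x * y ^ (l + 1) := by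
          rw [pow_succ]; linear_combination -(y ^ l) * hxy
        have ew : amW x y (l + 1) - amW x y l = (1 - x) * (y ^ (l + 1) - 1) := by
          unfold amW; rw [eq2]; push_cast; ring
        rw [eq1] at ha
        set q := x ^ (m - (l + 1)) with hqd
        have hs : (1 - x) * (y ^ (l + 1) - 1) ≤ (1 - x) * (q * (t 1 - t 0)) := by
          rw [← ew]; linarith
        have hs2 := le_of_mul_le_mul_left hs (by linarith)
        have hd := mul_nonneg hD.le (sub_nonneg.2 h12)
        simp
        nlinarith
    · rw [h] at hi ⊢
      have ha := hi ⟨m - 1, by omega⟩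
      have hb := hi ⟨m + 1, by omega⟩
      dsimp only at ha hb
      rw [hC _ (by omega), hT, hcC _ le_rfl, hcC _ (by omega)] at ha
      rw [hZ, hT, hcC _ le_rfl, hcZ, ← hc] at hb
      rw [hT, hT]
      have e1 : x ^ (m - (m - 1)) = x := by
        rw [show m - (m - 1) = 1 by omega, pow_one]
      rw [e1] at ha
      have ew : c - amW x y (m - 1) = (1 - x) * (y ^ m - 1) := by
        obtain ⟨l, hl⟩ : ∃ l, m = l + 1 := ⟨m - 1, by omega⟩
        have eq2 : y ^ l = x * y ^ (l + 1) := by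
          rw [pow_succ]; linear_combination -(y ^ l) * hxy
        rw [hc, hl, Nat.add_sub_cancel]
        unfold amW; rw [eq2]; push_cast; ring
      have ec : y ^ m - c = 1 + m * (1 - x) := by rw [hc]; unfold amW; ring
      rw [← hc] at ha
      have hD2 : x ^ m < 1 := pow_lt_one₀ hx.le hx1 (by omega)
      set D := x ^ m with hDd
      have hs : (1 - D) * c ≤ (1 - D) * ((t 1 - t 0) + D * (t 2 - t 1)) := by linarith
      have hs2 := le_of_mul_le_mul_left hs (by linarith)
      have hs3 := mul_le_mul_of_nonneg_left hs2 hx.le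
      have hs4 : (1 - x) * (y ^ m - 1) ≤
          (1 - x) * (t 1 - t 0) + D * D * (t 3 - t 2) := by rw [← ew]; linarith
      have hs5 := mul_nonneg hD.le (sub_nonneg.2 h12)
      have hs6 : 0 ≤ (1 - x) * (D * (t 2 - t 1)) := mul_nonneg (by linarith) hs5
      have hs7 : x * (y ^ m - c) = x * (1 + m * (1 - x)) := by rw [ec]
      have hs8 : 0 ≤ m * x * x := by positivity
      simp
      linarith
    · rw [h, hZ, hZ]
      have g1 : 0 ≤ (1 - x ^ m) * t 0 := mul_nonneg (by linarith) h0
      have g2 : 0 ≤ (x ^ m - x ^ m * x ^ m) * t 1 := mul_nonneg (by nlinarith) (ht0 1)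
      have g3 : 0 ≤ x ^ m * x ^ m * t 3 := mul_nonneg (by positivity) (ht0 3)
      simp
      linarith
  · dsimp only
    rw [hT]
    simp
    have : y ^ m - c = 1 + m * (1 - x) := by rw [hc]; unfold amW; ring
    linarith
end
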